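/- arXiv:1406.5462 — 2 statements merged into one kernel-verified Lean document; each statement's English description precedes it below -/
import Mathlib

section
/- Let β > 0 with β not an integer, and let r_β^± be the Beurling–Selberg majorant and minorant of χ_{[−β,β]}. Then (1/2)·M(r_β^±) = (β ± 1/2) − 1/(2π²β) + sin(2πβ)/(4π³β²) − (1/(4π²))·Σ_{n∈ℤ} sgn(n^±)/(n−β)² · (2 + sin(2πβ)/(π(n−β))), where sgn(n^±) = sgn(n) for n ≠ 0 and sgn(0^±) = ±1 (the '+' equation uses sgn(0^+) = +1 throughout, the '−' equation uses sgn(0^−) = −1). -/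
open Filter MeasureTheory Real Complex

/-- The Beurling function `H₀(x) = (sin πx/π)² {Σ_{m∈ℤ} sgn(m)/(x−m)² + 2/x}`. -/
noncomputable def H0 (x : ℝ) : ℝ :=
  (Real.sin (π * x) / π) ^ 2 * ((∑' m : ℤ, (Int.sign m : ℝ) / (x - m) ^ 2) + 2 / x)

/-- `H₁(x) = (sin πx/(πx))²`. -/
noncomputable def H1 (x : ℝ) : ℝ := (Real.sin (π * x) / (π * x)) ^ 2

/-- Beurling's majorant `H⁺ = H₀ + H₁` of `sgn`. -/
noncomputable def Hplus (x : ℝ) : ℝ := H0 x + H1 x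

/-- Beurling's minorant `H⁻ = H₀ − H₁` of `sgn`. -/
noncomputable def Hminus (x : ℝ) : ℝ := H0 x - H1 x

/-- The Beurling–Selberg majorant `r_β⁺(x) = ½{H⁺(x+β) + H⁺(−x+β)}` of `χ_{[−β,β]}`. -/
noncomputable def rPlus (β : ℝ) (x : ℝ) : ℝ := (Hplus (x + β) + Hplus (-x + β)) / 2

/-- The Beurling–Selberg minorant `r_β⁻(x) = ½{H⁻(x+β) + H⁻(−x+β)}` of `χ_{[−β,β]}`. -/
noncomputable def rMinus (β : ℝ) (x : ℝ) : ℝ := (Hminus (x + β) + Hminus (-x + β)) / 2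

/-- The pair correlation density `1 - (sin πx / (πx))²`. -/
noncomputable def pairCorKernel (x : ℝ) : ℝ := 1 - (Real.sin (π * x) / (π * x)) ^ 2

/-- `M(R) = ∫ R(x) {1 - (sin πx/(πx))²} dx`. -/
noncomputable def Mpc (R : ℝ → ℝ) : ℝ := ∫ x : ℝ, R x * pairCorKernel x

/-- `sgn(n⁺)`: the sign of `n`, with `sgn(0⁺) = +1`. -/
noncomputable def sgnP (n : ℤ) : ℝ := if n = 0 then 1 else (Int.sign n : ℝ)

/-- `sgn(n⁻)`: the sign of `n`, with `sgn(0⁻) = −1`. -/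
noncomputable def sgnM (n : ℤ) : ℝ := if n = 0 then -1 else (Int.sign n : ℝ)


lemma H1_sinc {x : ℝ} (hx : x ≠ 0) : H1 x = (sinc (π * x)) ^ 2 := by
  rw [H1, sinc_of_ne_zero (mul_ne_zero pi_ne_zero hx)]

lemma H1_nonneg (x : ℝ) : 0 ≤ H1 x := sq_nonneg _

lemma H1_le_one (x : ℝ) : H1 x ≤ 1 := by
  by_cases hx : x = 0
  · simp [H1, hx]
  · rw [H1_sinc hx, ← sq_abs]
    exact pow_le_one₀ (abs_nonneg _) (abs_sinc_le_one _)

lemma H1_neg (x : ℝ) : H1 (-x) = H1 x := by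
  simp [H1]

lemma H1_meas : Measurable H1 := by
  unfold H1; fun_prop

lemma H1_le (x : ℝ) : H1 x ≤ 2 * (1 + x ^ 2)⁻¹ := by
  have h1 := H1_le_one x
  rw [← div_eq_mul_inv, le_div_iff₀ (by positivity)]
  have : H1 x * x ^ 2 ≤ 1 := by
    by_cases hx : x = 0
    · simp [hx]
    · have e : H1 x * x ^ 2 = Real.sin (π * x) ^ 2 / π ^ 2 := by
        unfold H1; field_simp
      rw [e, div_le_one (by positivity)]
      have := Real.sin_sq_le_one (π * x)
      nlinarith [pi_gt_three]
  nlinarith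

lemma H1_integrable : Integrable H1 := by
  refine (integrable_inv_one_add_sq.const_mul 2).mono' H1_meas.aestronglyMeasurable ?_
  refine Eventually.of_forall fun x => ?_
  rw [Real.norm_eq_abs, abs_of_nonneg (H1_nonneg x)]
  exact H1_le x

/-- integral of (1-t) cos(wt) -/
lemma int_cos (w : ℝ) (hw : w ≠ 0) :
    ∫ t in (0:ℝ)..1, (1 - t) * Real.cos (w * t) = (1 - Real.cos w) / w ^ 2 := by
  have : ∀ t ∈ Set.uIcc (0:ℝ) 1, HasDerivAt
      (fun t => (1 - t) * (Real.sin (w * t) / w) - Real.cos (w * t) / w ^ 2)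
      ((1 - t) * Real.cos (w * t)) t := by
    intro t _
    have hl : HasDerivAt (fun t : ℝ => w * t) w t := by
      simpa using (hasDerivAt_id t).const_mul w
    have h1 : HasDerivAt (fun t : ℝ => 1 - t) (-1) t := by
      simpa using (hasDerivAt_id t).const_sub 1
    exact ((h1.mul (hl.sin.div_const w)).sub (hl.cos.div_const (w ^ 2))).congr_deriv (by simp; field_simp; ring)
  rw [intervalIntegral.integral_eq_sub_of_hasDerivAt this
    ((by fun_prop : Continuous _).intervalIntegrable _ _)]
  simp; ring

lemma int_sin (w : ℝ) (hw : w ≠ 0) :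
    ∫ t in (0:ℝ)..1, (1 - t) * Real.sin (w * t) = 1 / w - Real.sin w / w ^ 2 := by
  have : ∀ t ∈ Set.uIcc (0:ℝ) 1, HasDerivAt
      (fun t => -((1 - t) * (Real.cos (w * t) / w)) - Real.sin (w * t) / w ^ 2)
      ((1 - t) * Real.sin (w * t)) t := by
    intro t _
    have hl : HasDerivAt (fun t : ℝ => w * t) w t := by
      simpa using (hasDerivAt_id t).const_mul w
    have h1 : HasDerivAt (fun t : ℝ => 1 - t) (-1) t := by
      simpa using (hasDerivAt_id t).const_sub 1
    exact ((h1.mul (hl.cos.div_const w)).neg.sub (hl.sin.div_const (w ^ 2))).congr_deriv (by simp; field_simp; ring)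
  rw [intervalIntegral.integral_eq_sub_of_hasDerivAt this
    ((by fun_prop : Continuous _).intervalIntegrable _ _)]
  simp; ring

lemma int_cos2 (w : ℝ) (hw : w ≠ 0) :
    ∫ t in (0:ℝ)..1, (1 - t) * ((1 - t) * Real.cos (w * t))
      = 2 * (1 / w ^ 2 - Real.sin w / w ^ 3) := by
  have : ∀ t ∈ Set.uIcc (0:ℝ) 1, HasDerivAt
      (fun t => (1 - t) ^ 2 * (Real.sin (w * t) / w)
        + 2 * (-((1 - t) * (Real.cos (w * t) / w)) - Real.sin (w * t) / w ^ 2) / w)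
      ((1 - t) * ((1 - t) * Real.cos (w * t))) t := by
    intro t _
    have hl : HasDerivAt (fun t : ℝ => w * t) w t := by
      simpa using (hasDerivAt_id t).const_mul w
    have h1 : HasDerivAt (fun t : ℝ => 1 - t) (-1) t := by
      simpa using (hasDerivAt_id t).const_sub 1
    exact (((h1.pow 2).mul (hl.sin.div_const w)).add ((((h1.mul (hl.cos.div_const w)).neg.sub (hl.sin.div_const (w ^ 2))).const_mul 2).div_const w)).congr_deriv (by simp; field_simp; ring)
  rw [intervalIntegral.integral_eq_sub_of_hasDerivAt this
    ((by fun_prop : Continuous _).intervalIntegrable _ _)]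
  simp; field_simp; ring

lemma H1_eq_int (y : ℝ) (hy : y ≠ 0) :
    H1 y = 2 * ∫ t in (0:ℝ)..1, (1 - t) * Real.cos (2 * π * y * t) := by
  rw [int_cos _ (by positivity), H1, show 2 * π * y = 2 * (π * y) by ring, Real.cos_two_mul,
    Real.cos_sq']
  field_simp; ring

lemma J_eq_int (y : ℝ) :
    (Real.sin (π * y) / π) ^ 2 * (2 / y) = (2 / π) * ∫ t in (0:ℝ)..1, Real.sin (2 * π * y * t) := by
  by_cases hy : y = 0
  · simp [hy]
  have : ∀ t ∈ Set.uIcc (0:ℝ) 1, HasDerivAt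
      (fun t => -(Real.cos (2 * π * y * t) / (2 * π * y)))
      (Real.sin (2 * π * y * t)) t := by
    intro t _
    have hl : HasDerivAt (fun t : ℝ => 2 * π * y * t) (2 * π * y) t := by
      simpa using (hasDerivAt_id t).const_mul (2 * π * y)
    exact ((hl.cos.div_const (2 * π * y)).neg).congr_deriv (by simp; field_simp)
  rw [intervalIntegral.integral_eq_sub_of_hasDerivAt this
    ((by fun_prop : Continuous _).intervalIntegrable _ _)]
  simp only [mul_one, mul_zero, Real.cos_zero]
  rw [show 2 * π * y = 2 * (π * y) by ring, Real.cos_two_mul, Real.cos_sq']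
  field_simp; ring

noncomputable def tri (t : ℝ) : ℝ := max (1 - |t|) 0

lemma tri_cont : Continuous tri := by unfold tri; fun_prop

lemma tri_zero {t : ℝ} (h : 1 ≤ |t|) : tri t = 0 := by
  unfold tri; rw [max_eq_right]; linarith

lemma tri_integrable : Integrable tri := by
  refine tri_cont.integrable_of_hasCompactSupport ?_
  refine HasCompactSupport.intro (K := Set.Icc (-1) 1) isCompact_Icc fun t ht => tri_zero ?_
  by_contra h
  push Not at h
  exact ht ⟨(abs_lt.1 h).1.le, (abs_lt.1 h).2.le⟩

lemma int_odd (f : ℝ → ℝ) (h : ∀ x, f (-x) = - f x) : ∫ x, f x = 0 := by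
  have h1 := integral_neg_eq_self f volume
  simp only [h, integral_neg] at h1
  linarith

lemma int_tri_cos (y : ℝ) (hy : y ≠ 0) : ∫ t, tri t * Real.cos (2 * π * y * t) = H1 y := by
  have e : ∀ t, tri t * Real.cos (2 * π * y * t)
      = (fun s => tri s * Real.cos (2 * π * y * s)) |t| := by
    intro t
    rcases abs_choice t with h | h <;> simp [h, tri]
  rw [integral_congr_ae (Eventually.of_forall e)]
  rw [integral_comp_abs (f := fun s => tri s * Real.cos (2 * π * y * s)), H1_eq_int y hy]
  congr 1
  rw [intervalIntegral.integral_of_le zero_le_one]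
  have : ∫ x in Set.Ioc (0:ℝ) 1, (1 - x) * Real.cos (2 * π * y * x)
      = ∫ x in Set.Ioc (0:ℝ) 1, tri x * Real.cos (2 * π * y * x) := by
    refine setIntegral_congr_fun measurableSet_Ioc fun x hx => ?_
    simp only [tri]
    rw [abs_of_pos hx.1, max_eq_left (by linarith [hx.2])]
  rw [this]
  refine setIntegral_eq_of_subset_of_forall_sdiff_eq_zero measurableSet_Ioi
    (fun x hx => hx.1) ?_
  intro x hx
  rw [tri_zero, zero_mul]
  have h0 : 0 < x := hx.1
  rw [abs_of_pos h0]
  by_contra h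
  exact hx.2 ⟨h0, by linarith⟩

open FourierTransform

lemma bdd_integrable {f g : ℝ → ℝ} (hf : Integrable f) (hg : Measurable g) (C : ℝ)
    (h : ∀ x, |g x| ≤ C) : Integrable (fun x => f x * g x) :=
  hf.mul_bdd (c := C) hg.aestronglyMeasurable (Eventually.of_forall h)

/-- complex exponentials against an even function -/
lemma int_even_exp (f : ℝ → ℝ) (hf : Integrable f) (he : ∀ x, f (-x) = f x) (w : ℝ) :
    ∫ t, Complex.exp ((w * t : ℝ) * I) * (f t : ℂ) = ((∫ t, f t * Real.cos (w * t) : ℝ) : ℂ) := by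
  have hc : Integrable (fun t => f t * Real.cos (w * t)) :=
    bdd_integrable hf (by fun_prop) 1 (fun x => Real.abs_cos_le_one _)
  have hs : Integrable (fun t => f t * Real.sin (w * t)) :=
    bdd_integrable hf (by fun_prop) 1 (fun x => Real.abs_sin_le_one _)
  have e : ∀ t : ℝ, Complex.exp ((w * t : ℝ) * I) * (f t : ℂ)
      = ((f t * Real.cos (w * t) : ℝ) : ℂ) + ((f t * Real.sin (w * t) : ℝ) : ℂ) * I := by
    intro t
    rw [Complex.exp_mul_I, ← Complex.ofReal_cos, ← Complex.ofReal_sin]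
    push_cast; ring
  simp_rw [e]
  have hc' : Integrable (fun t => ((f t * Real.cos (w * t) : ℝ) : ℂ)) := hc.ofReal
  have hs' : Integrable (fun t => ((f t * Real.sin (w * t) : ℝ) : ℂ)) := hs.ofReal
  rw [integral_add hc' (hs'.mul_const I), integral_mul_const, integral_complex_ofReal,
    integral_complex_ofReal, int_odd (fun t => f t * Real.sin (w * t))]
  · simp
  · intro x; simp [he]

lemma fourier_tri (y : ℝ) (hy : y ≠ 0) : 𝓕 (fun t => (tri t : ℂ)) y = (H1 y : ℂ) := by
  rw [Real.fourier_eq', ← int_tri_cos y hy]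
  have := int_even_exp tri tri_integrable (by simp [tri]) (-2 * π * y)
  simp only [smul_eq_mul]
  have e2 : ∀ t, tri t * Real.cos (-2 * π * y * t) = tri t * Real.cos (2 * π * y * t) := by
    intro t
    rw [← Real.cos_neg]; congr 2; ring
  simp only [e2] at this
  rw [← this]
  congr 1
  ext t
  congr 3
  simp; ring

lemma ne_zero_ae (c : ℝ) : ∀ᵐ x : ℝ, x ≠ c := by
  simp [ae_iff, measure_singleton]

lemma int_H1_cos (t : ℝ) : ∫ x, H1 x * Real.cos (2 * π * t * x) = tri t := by
  have hae : 𝓕 (fun t => (tri t : ℂ)) =ᵐ[volume] fun y => (H1 y : ℂ) := by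
    filter_upwards [ne_zero_ae 0] with y hy using fourier_tri y hy
  have h := (Complex.continuous_ofReal.comp tri_cont).fourierInv_fourier_eq
    tri_integrable.ofReal (H1_integrable.ofReal.congr hae.symm)
  have h2 := congrFun h t
  rw [Real.fourierInv_eq'] at h2
  have h3 := int_even_exp H1 H1_integrable H1_neg (2 * π * t)
  have h4 : ((∫ x, H1 x * Real.cos (2 * π * t * x) : ℝ) : ℂ) = (tri t : ℂ) := by
    rw [← h3]
    refine Eq.trans ?_ h2
    refine integral_congr_ae ?_
    filter_upwards [hae] with x hx
    have hx' : 𝓕 (Complex.ofReal ∘ tri) x = (H1 x : ℂ) := hx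
    rw [hx', smul_eq_mul]
    congr 2
    simp; ring
  exact_mod_cast h4

lemma int_H1 : ∫ x, H1 x = 1 := by
  simpa [tri] using int_H1_cos 0

/-- Fubini for a weight g on [0,1] -/
lemma fub (g : ℝ → ℝ) (hg : Continuous g) (k : ℝ → ℝ) (hk : Continuous k) (hk1 : ∀ u, |k u| ≤ 1)
    (a : ℝ) :
    ∫ x, H1 x * ∫ t in (0:ℝ)..1, g t * k (2 * π * (x + a) * t)
      = ∫ t in (0:ℝ)..1, g t * ∫ x, H1 x * k (2 * π * (x + a) * t) := by
  simp_rw [intervalIntegral.integral_of_le zero_le_one, ← integral_const_mul]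
  rw [integral_integral_swap]
  · refine setIntegral_congr_fun measurableSet_Ioc fun t _ => ?_
    refine integral_congr_ae (Eventually.of_forall fun x => ?_)
    simp only; ring
  · have hgi : Integrable g (volume.restrict (Set.Ioc (0:ℝ) 1)) :=
      (hg.integrableOn_Icc).mono_set Set.Ioc_subset_Icc_self
    have h := H1_integrable.mul_prod hgi
    have h2 : Integrable (fun z : ℝ × ℝ => (H1 z.1 * g z.2) * k (2 * π * (z.1 + a) * z.2))
        (volume.prod (volume.restrict (Set.Ioc (0:ℝ) 1))) := by
      refine h.mul_bdd (c := 1) ?_ (Eventually.of_forall fun z => hk1 _)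
      exact (by fun_prop : Continuous fun z : ℝ × ℝ => k (2 * π * (z.1 + a) * z.2)).aestronglyMeasurable
    refine h2.congr (Eventually.of_forall fun z => ?_)
    simp only [Function.uncurry]; ring

lemma int_H1_sin0 (t : ℝ) : ∫ x, H1 x * Real.sin (2 * π * t * x) = 0 :=
  int_odd _ fun x => by simp [H1_neg]

lemma H1_cos_int (w : ℝ) : Integrable (fun x => H1 x * Real.cos (w * x)) :=
  bdd_integrable H1_integrable (by fun_prop) 1 (fun x => Real.abs_cos_le_one _)
lemma H1_sin_int (w : ℝ) : Integrable (fun x => H1 x * Real.sin (w * x)) :=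
  bdd_integrable H1_integrable (by fun_prop) 1 (fun x => Real.abs_sin_le_one _)

lemma int_H1_cos_shift (t a : ℝ) :
    ∫ x, H1 x * Real.cos (2 * π * (x + a) * t) = tri t * Real.cos (2 * π * a * t) := by
  have e : ∀ x, H1 x * Real.cos (2 * π * (x + a) * t)
      = (H1 x * Real.cos (2 * π * t * x)) * Real.cos (2 * π * a * t)
       - (H1 x * Real.sin (2 * π * t * x)) * Real.sin (2 * π * a * t) := by
    intro x
    rw [show 2 * π * (x + a) * t = 2 * π * t * x + 2 * π * a * t by ring, Real.cos_add]; ring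
  simp_rw [e]
  rw [integral_sub ((H1_cos_int _).mul_const _) ((H1_sin_int _).mul_const _),
    integral_mul_const, integral_mul_const, int_H1_cos, int_H1_sin0]; ring

lemma int_H1_sin_shift (t a : ℝ) :
    ∫ x, H1 x * Real.sin (2 * π * (x + a) * t) = tri t * Real.sin (2 * π * a * t) := by
  have e : ∀ x, H1 x * Real.sin (2 * π * (x + a) * t)
      = (H1 x * Real.cos (2 * π * t * x)) * Real.sin (2 * π * a * t)
       + (H1 x * Real.sin (2 * π * t * x)) * Real.cos (2 * π * a * t) := by
    intro x
    rw [show 2 * π * (x + a) * t = 2 * π * t * x + 2 * π * a * t by ring, Real.sin_add]; ring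
  simp_rw [e]
  rw [integral_add ((H1_cos_int _).mul_const _) ((H1_sin_int _).mul_const _),
    integral_mul_const, integral_mul_const, int_H1_cos, int_H1_sin0]; ring

lemma tri_eq {t : ℝ} (ht : t ∈ Set.uIcc (0:ℝ) 1) : tri t = 1 - t := by
  rw [Set.uIcc_of_le zero_le_one] at ht
  rw [tri, abs_of_nonneg ht.1, max_eq_left (by linarith [ht.2])]

lemma conv_H1 (a : ℝ) (ha : a ≠ 0) :
    ∫ x, H1 x * H1 (x + a) = 1 / (π ^ 2 * a ^ 2) * (1 - Real.sin (2 * π * a) / (2 * π * a)) := by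
  have e : ∫ x, H1 x * H1 (x + a) = ∫ x, 2 * (H1 x * ∫ t in (0:ℝ)..1, (1 - t) * Real.cos (2 * π * (x + a) * t)) := by
    refine integral_congr_ae ?_
    filter_upwards [ne_zero_ae (-a)] with x hx
    rw [H1_eq_int (x + a) (fun h => hx (by linarith))]; ring
  rw [e, integral_const_mul, fub (fun t => 1 - t) (by fun_prop) Real.cos Real.continuous_cos Real.abs_cos_le_one]
  simp_rw [int_H1_cos_shift]
  rw [intervalIntegral.integral_congr (g := fun t => (1 - t) * ((1 - t) * Real.cos (2 * π * a * t)))]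
  · rw [int_cos2 _ (by positivity)]
    field_simp
  · intro t ht
    simp only [tri_eq ht]

lemma conv_J (a : ℝ) (ha : a ≠ 0) :
    ∫ x, H1 x * ((Real.sin (π * (x + a)) / π) ^ 2 * (2 / (x + a)))
      = 1 / (π ^ 2 * a) - Real.sin (2 * π * a) / (2 * π ^ 3 * a ^ 2) := by
  have e : ∫ x, H1 x * ((Real.sin (π * (x + a)) / π) ^ 2 * (2 / (x + a)))
     = ∫ x, (2 / π) * (H1 x * ∫ t in (0:ℝ)..1, (fun _ => 1) t * Real.sin (2 * π * (x + a) * t)) := by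
    refine integral_congr_ae (Eventually.of_forall fun x => ?_)
    simp only [J_eq_int, one_mul]; ring
  rw [e, integral_const_mul, fub (fun t => 1) (by fun_prop) Real.sin Real.continuous_sin Real.abs_sin_le_one]
  simp_rw [int_H1_sin_shift]
  rw [intervalIntegral.integral_congr (g := fun t => (1 - t) * Real.sin (2 * π * a * t))]
  · rw [int_sin _ (by positivity)]
    field_simp
  · intro t ht
    simp only [tri_eq ht, one_mul]

lemma fcoef (x : ℝ) (hx : ∀ n : ℤ, x ≠ n) (n : ℤ) :
    ‖fourierCoeffOn (zero_lt_one (α := ℝ)) (fun t => Complex.exp ((2 * π * x * t : ℝ) * I)) n‖ ^ 2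
      = H1 (x - n) := by
  have hn : x - n ≠ 0 := sub_ne_zero.2 (hx n)
  have hc : ((2 * π * (x - n) : ℝ) : ℂ) * I ≠ 0 := by
    refine mul_ne_zero ?_ I_ne_zero
    exact_mod_cast (by positivity : (2 * π * (x - n)) ≠ 0)
  rw [fourierCoeffOn_eq_integral]
  have e : ∀ t : ℝ, (fourier (-n) (t : AddCircle ((1:ℝ) - 0)) : ℂ) • Complex.exp ((2 * π * x * t : ℝ) * I)
      = Complex.exp ((((2 * π * (x - n) : ℝ) : ℂ) * I) * t) := by
    intro t
    rw [fourier_coe_apply, smul_eq_mul, ← Complex.exp_add]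
    congr 1
    push_cast
    ring
  simp_rw [e]
  rw [integral_exp_mul_complex hc]
  have e2 := Complex.norm_exp_I_mul_ofReal_sub_one (2 * π * (x - n))
  simp only [ofReal_one, ofReal_zero, mul_one, mul_zero, Complex.exp_zero, sub_zero, div_one, one_smul]
  rw [norm_div, mul_comm _ I, e2, norm_mul I, norm_I, one_mul, Complex.norm_real, H1, div_pow, div_pow,
    norm_eq_abs, norm_eq_abs, sq_abs, sq_abs,
    show 2 * π * (x - n) / 2 = π * (x - n) by ring]
  field_simp

lemma sum_H1 (x : ℝ) (hx : ∀ n : ℤ, x ≠ n) : HasSum (fun n : ℤ => H1 (x - n)) 1 := by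
  have hL : MemLp (fun t : ℝ => Complex.exp ((2 * π * x * t : ℝ) * I)) 2
      (volume.restrict (Set.Ioc (0:ℝ) 1)) := by
    refine MemLp.of_bound (by fun_prop) 1 (Eventually.of_forall fun t => ?_)
    rw [Complex.norm_exp_ofReal_mul_I]
  have := hasSum_sq_fourierCoeffOn (zero_lt_one (α := ℝ)) hL
  simp only [fcoef x hx, Complex.norm_exp_ofReal_mul_I] at this
  simpa using this

lemma hasSum_cg {ι : Type*} {f g : ι → ℝ} {a : ℝ} (h : HasSum f a) (e : ∀ n, g n = f n) :
    HasSum g a := by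
  rwa [funext e]

lemma H1_shift (x : ℝ) (n : ℤ) : H1 (x - n) = (Real.sin (π * x) / π) ^ 2 * (1 / (x - n) ^ 2) := by
  have : Real.sin (π * (x - n)) ^ 2 = Real.sin (π * x) ^ 2 := by
    rw [show π * (x - n) = π * x - n * π by ring, Real.sin_sub_int_mul_pi, mul_pow]
    rcases neg_one_pow_eq_or ℝ n.natAbs with h | h <;>
    rcases Int.even_or_odd n with h' | h' <;> simp [h'.neg_one_zpow]
  rw [H1, div_pow, this, div_pow, mul_pow, div_mul_div_comm, mul_one]

noncomputable def Jf (y : ℝ) : ℝ := (Real.sin (π * y) / π) ^ 2 * (2 / y)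

lemma H0_eq (x : ℝ) : H0 x = (∑' m : ℤ, (Int.sign m : ℝ) * H1 (x - m)) + Jf x := by
  rw [H0, Jf, mul_add, ← tsum_mul_left]
  congr 2
  ext m
  rw [H1_shift]; ring

lemma summ (x : ℝ) (s : ℤ → ℝ) (hs : ∀ n, |s n| ≤ 1) : Summable fun n : ℤ => s n * H1 (x - n) := by
  by_cases hx : ∀ n : ℤ, x ≠ n
  · refine (sum_H1 x hx).summable.of_norm_bounded fun n => ?_
    rw [norm_mul, norm_eq_abs, norm_eq_abs, abs_of_nonneg (H1_nonneg _)]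
    exact mul_le_of_le_one_left (H1_nonneg _) (hs n)
  · push Not at hx
    obtain ⟨k, rfl⟩ := hx
    have : ∀ n : ℤ, H1 ((k : ℝ) - n) = 0 := by
      intro n
      rw [H1_shift, mul_comm π, Real.sin_int_mul_pi]; simp
    simp [this]

lemma sign_le (n : ℤ) : |((Int.sign n : ℤ) : ℝ)| ≤ 1 := by
  rcases lt_trichotomy n 0 with h | h | h
  · simp [Int.sign_eq_neg_one_of_neg h]
  · simp [h]
  · simp [Int.sign_eq_one_of_pos h]

lemma telescope (x : ℝ) (hx : 0 < x) :
    HasSum (fun n : ℕ => 1 / (x + n) - 1 / (x + n + 1)) (1 / x) := by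
  rw [hasSum_iff_tendsto_nat_of_nonneg]
  · have e : ∀ N : ℕ, ∑ n ∈ Finset.range N, (1 / (x + n) - 1 / (x + n + 1)) = 1 / x - 1 / (x + N) := by
      intro N
      induction N with
      | zero => simp
      | succ k ih => rw [Finset.sum_range_succ, ih]; push_cast; ring
    simp_rw [e]
    have h : Tendsto (fun N : ℕ => 1 / (x + N)) atTop (nhds 0) := by
      simp_rw [one_div]
      exact (tendsto_atTop_add_const_left _ x tendsto_natCast_atTop_atTop).inv_tendsto_atTop
    simpa using tendsto_const_nhds.sub h
  · intro n
    rw [sub_nonneg]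
    exact one_div_le_one_div_of_le (by positivity) (by linarith)

lemma S_bound (x : ℝ) (hx : 0 < x) :
    ∃ S, HasSum (fun n : ℕ => 1 / (x + n + 1) ^ 2) S ∧ S ≤ 1 / x ∧ 1 / (x + 1) ≤ S := by
  have h1 := telescope x hx
  have h2 := telescope (x + 1) (by linarith)
  have b1 : ∀ n : ℕ, 1 / (x + n + 1) ^ 2 ≤ 1 / (x + n) - 1 / (x + n + 1) := by
    intro n
    have : 0 < x + n := by positivity
    rw [div_sub_div _ _ (by positivity) (by positivity), div_le_div_iff₀ (by positivity) (by positivity)]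
    nlinarith
  have b2 : ∀ n : ℕ, 1 / (x + 1 + n) - 1 / (x + 1 + n + 1) ≤ 1 / (x + n + 1) ^ 2 := by
    intro n
    have : 0 < x + n := by positivity
    rw [div_sub_div _ _ (by positivity) (by positivity), div_le_div_iff₀ (by positivity) (by positivity)]
    nlinarith
  have hs : Summable (fun n : ℕ => 1 / (x + n + 1) ^ 2) :=
    h1.summable.of_nonneg_of_le (fun n => by positivity) b1
  exact ⟨_, hs.hasSum, hasSum_le b1 hs.hasSum h1, hasSum_le b2 h2 hs.hasSum⟩

lemma H0_bound_pos (x : ℝ) (hx : 0 < x) (hn : ∀ n : ℤ, x ≠ n) : |H0 x - 1| ≤ H1 x := by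
  obtain ⟨S, hS, hS1, hS2⟩ := S_bound x hx
  set s := (Real.sin (π * x) / π) ^ 2 with hs
  have hs0 : 0 ≤ s := sq_nonneg _
  have hH1 : H1 x = s * (1 / x ^ 2) := by simpa using H1_shift x 0
  have A := (sum_H1 x hn).sub (summ x (fun m => (Int.sign m : ℝ)) sign_le).hasSum
  have B : HasSum (fun m : ℤ => H1 (x - m) - (Int.sign m : ℝ) * H1 (x - m))
      (s * (1 / x ^ 2) + s * (2 * S)) := by
    refine HasSum.of_nat_of_neg_add_one ?_ ?_
    · convert hasSum_single (0 : ℕ) ?_ using 1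
      · simp [hH1]
      · intro n h0
        have : (0 : ℤ) < (n : ℤ) := by omega
        rw [Int.sign_eq_one_of_pos this]; simp
    · have hh := (hS.mul_left 2).mul_left s
      refine hasSum_cg hh (fun n => ?_)
      rw [Int.sign_eq_neg_one_of_neg (by omega), H1_shift, ← hs]
      push_cast
      rw [show x - (-((n:ℝ) + 1)) = x + n + 1 by ring]
      ring
  have e := A.unique B
  have e2 : H0 x - 1 = -(s * (1 / x ^ 2 + 2 * S - 2 / x)) := by
    rw [H0_eq, Jf, ← hs]
    linear_combination -e
  rw [e2, abs_neg, abs_mul, abs_of_nonneg hs0, hH1]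
  refine mul_le_mul_of_nonneg_left ?_ hs0
  have h3 : 1 / x - 1 / x ^ 2 ≤ 1 / (x + 1) := by
    rw [div_sub_div _ _ (by positivity) (by positivity), div_le_div_iff₀ (by positivity) (by positivity)]
    nlinarith
  have h4 : 2 / x = 2 * (1 / x) := by ring
  rw [abs_le]
  constructor <;> linarith

lemma H0_neg (x : ℝ) : H0 (-x) = - H0 x := by
  rw [H0, H0, mul_neg, Real.sin_neg, ← (Equiv.neg ℤ).tsum_eq]
  have : ∀ m : ℤ, ((Int.sign ((Equiv.neg ℤ) m) : ℤ) : ℝ) / (-x - ((Equiv.neg ℤ m : ℤ) : ℝ)) ^ 2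
      = - ((Int.sign m : ℝ) / (x - m) ^ 2) := by
    intro m
    simp only [Equiv.neg_apply, Int.sign_neg]
    push_cast
    rw [show (-x - -(m:ℝ)) ^ 2 = (x - m) ^ 2 by ring]; ring
  simp_rw [this]
  rw [tsum_neg, div_neg]; ring

lemma H0_bound (x : ℝ) (hn : ∀ n : ℤ, x ≠ n) : |H0 x - Real.sign x| ≤ H1 x := by
  rcases lt_trichotomy x 0 with h | h | h
  · have := H0_bound_pos (-x) (by linarith) (fun n hh => hn (-n) (by push_cast; linarith))
    rw [Real.sign_of_neg h, ← H1_neg, ← abs_neg]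
    rw [H0_neg] at this
    convert this using 2; ring
  · exact absurd (by simpa using h) (hn 0)
  · rw [Real.sign_of_pos h]; exact H0_bound_pos x h hn

lemma nonint_ae (a : ℝ) : ∀ᵐ x : ℝ, ∀ n : ℤ, x + a ≠ n := by
  rw [ae_all_iff]
  intro n
  filter_upwards [ne_zero_ae (n - a)] with x hx h
  exact hx (by linarith)

lemma H0_meas : Measurable H0 := by
  unfold H0
  refine Measurable.mul (by fun_prop) (Measurable.add ?_ (by fun_prop))
  exact Measurable.tsum fun m => by fun_prop

lemma sign_meas : Measurable Real.sign := by
  unfold Real.sign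
  exact Measurable.ite measurableSet_Iio measurable_const
    (Measurable.ite measurableSet_Ioi measurable_const measurable_const)

noncomputable def Df (x : ℝ) : ℝ := H0 x - Real.sign x

lemma Df_int : Integrable Df := by
  refine H1_integrable.mono' (H0_meas.sub sign_meas).aestronglyMeasurable ?_
  filter_upwards [nonint_ae 0] with x hx
  exact H0_bound x (by simpa using hx)

lemma Df_zero : ∫ x, Df x = 0 := int_odd _ fun x => by
  simp only [Df, H0_neg, Real.sign_neg]; ring

lemma sign_box (β : ℝ) (hβ : 0 < β) :
    (fun x => Real.sign (x + β) + Real.sign (-x + β)) =ᵐ[volume]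
      (Set.Icc (-β) β).indicator (fun _ => (2:ℝ)) := by
  filter_upwards [ne_zero_ae β, ne_zero_ae (-β)] with x h1 h2
  rcases lt_or_gt_of_ne h1 with h1 | h1 <;> rcases lt_or_gt_of_ne h2 with h2 | h2
  · rw [Real.sign_of_neg (by linarith), Real.sign_of_pos (by linarith), Set.indicator_of_notMem]
    · norm_num
    · exact fun h => absurd h.1 (by linarith)
  · rw [Real.sign_of_pos (by linarith), Real.sign_of_pos (by linarith), Set.indicator_of_mem]
    · norm_num
    · exact ⟨h2.le, h1.le⟩
  · linarith
  · rw [Real.sign_of_pos (by linarith), Real.sign_of_neg (by linarith), Set.indicator_of_notMem]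
    · norm_num
    · exact fun h => absurd h.2 (by linarith)

lemma refl_int {f : ℝ → ℝ} (hf : Integrable f) (β : ℝ) : Integrable (fun x => f (-x + β)) := by
  simpa [neg_add_eq_sub] using hf.comp_sub_left β

lemma refl_integral (f : ℝ → ℝ) (β : ℝ) : ∫ x, f (-x + β) = ∫ x, f x := by
  simpa [neg_add_eq_sub] using integral_sub_left_eq_self f volume β

lemma H0_pair (β : ℝ) (hβ : 0 < β) :
    Integrable (fun x => H0 (x + β) + H0 (-x + β)) ∧ ∫ x, (H0 (x + β) + H0 (-x + β)) = 4 * β := by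
  have e : (fun x => H0 (x + β) + H0 (-x + β))
    =ᵐ[volume] fun x => Df (x + β) + Df (-x + β) + (Set.Icc (-β) β).indicator (fun _ => (2:ℝ)) x := by
    filter_upwards [sign_box β hβ] with x hx
    rw [← hx]; simp only [Df]; ring
  have i1 : Integrable (fun x => Df (x + β)) := Df_int.comp_add_right β
  have i2 := refl_int Df_int β
  have i3 : Integrable ((Set.Icc (-β) β).indicator (fun _ => (2:ℝ))) := by
    rw [integrable_indicator_iff measurableSet_Icc]
    exact continuous_const.integrableOn_Icc
  have i12 : Integrable (fun x => Df (x + β) + Df (-x + β)) := i1.add i2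
  constructor
  · exact (i12.add i3).congr e.symm
  · rw [integral_congr_ae e, integral_add i12 i3, integral_add i1 i2, refl_integral,
      integral_add_right_eq_self Df, Df_zero, integral_indicator measurableSet_Icc, setIntegral_const]
    simp only [measureReal_def, Real.volume_Icc, smul_eq_mul]
    rw [ENNReal.toReal_ofReal (by linarith)]
    ring

lemma Jf_meas : Measurable Jf := by unfold Jf; fun_prop

lemma Jf_le (x : ℝ) : |Jf x| ≤ 2 := by
  rw [Jf, J_eq_int, abs_mul, abs_of_pos (by positivity)]
  have := intervalIntegral.norm_integral_le_of_norm_le_const (a := 0) (b := 1) (C := 1)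
    (f := fun t => Real.sin (2 * π * x * t)) (fun t _ => Real.abs_sin_le_one _)
  simp only [sub_zero, abs_one, mul_one, norm_eq_abs] at this
  have h2 : 2 / π ≤ 1 := by rw [div_le_one (by positivity)]; linarith [pi_gt_three]
  have h3 : 0 < 2 / π := by positivity
  nlinarith

lemma sum_exchange (β : ℝ) (s : ℤ → ℝ) (hs : ∀ n, |s n| ≤ 1) :
    Integrable (fun x => H1 x * ∑' n : ℤ, s n * H1 (x + β - n)) ∧
    HasSum (fun n : ℤ => s n * ∫ x, H1 x * H1 (x + (β - n)))
      (∫ x, H1 x * ∑' n : ℤ, s n * H1 (x + β - n)) := by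
  have bs : ∀ᵐ x : ℝ, HasSum (fun n : ℤ => H1 x * H1 (x + β - n)) (H1 x) := by
    filter_upwards [nonint_ae β] with x hx
    simpa using (sum_H1 (x + β) hx).mul_left (H1 x)
  have bnd : ∀ (n : ℤ) (x : ℝ), ‖H1 x * (s n * H1 (x + β - n))‖ ≤ H1 x * H1 (x + β - n) := by
    intro n x
    rw [norm_mul, norm_mul, norm_eq_abs, norm_eq_abs, norm_eq_abs, abs_of_nonneg (H1_nonneg _),
      abs_of_nonneg (H1_nonneg _)]
    exact mul_le_mul_of_nonneg_left (mul_le_of_le_one_left (H1_nonneg _) (hs n)) (H1_nonneg _)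
  constructor
  · refine H1_integrable.mono' ?_ ?_
    · refine (H1_meas.mul (Measurable.tsum fun n => ?_)).aestronglyMeasurable
      exact (H1_meas.comp (by fun_prop)).const_mul _
    · filter_upwards [bs] with x hx
      rw [← tsum_mul_left]
      exact tsum_of_norm_bounded hx (bnd · x)
  · have := hasSum_integral_of_dominated_convergence (μ := volume)
      (F := fun (n : ℤ) x => H1 x * (s n * H1 (x + β - n)))
      (f := fun x => H1 x * ∑' n : ℤ, s n * H1 (x + β - n))
      (fun n x => H1 x * H1 (x + β - n)) ?_ (fun n => Eventually.of_forall (bnd n))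
      (bs.mono fun x h => h.summable) ?_ ?_
    · refine hasSum_cg this (fun n => ?_)
      rw [← integral_const_mul]
      congr 1; ext x
      rw [add_sub_assoc]; ring
    · intro n
      exact (H1_meas.mul ((H1_meas.comp (by fun_prop)).const_mul _)).aestronglyMeasurable
    · refine H1_integrable.congr ?_
      filter_upwards [bs] with x hx using hx.tsum_eq.symm
    · exact Eventually.of_forall fun x => (summ (x + β) s hs).hasSum.mul_left _

lemma sin_shift (β : ℝ) (n : ℤ) : Real.sin (2 * π * (β - n)) = Real.sin (2 * π * β) := by
  rw [show 2 * π * (β - n) = 2 * π * β - n * (2 * π) by ring, Real.sin_sub_int_mul_two_pi]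

lemma general (β : ℝ) (hβ : 0 < β) (hint : ∀ n : ℤ, β ≠ (n : ℝ)) (H : ℝ → ℝ) (σ : ℝ) (s : ℤ → ℝ)
    (hs : ∀ n, |s n| ≤ 1) (hH : ∀ y, H y = H0 y + σ * H1 y)
    (hH' : ∀ y, H y = (∑' n : ℤ, s n * H1 (y - n)) + Jf y) :
    (1 / 2) * Mpc (fun x => (H (x + β) + H (-x + β)) / 2) =
      (β + σ * (1 / 2)) - 1 / (2 * π ^ 2 * β) + Real.sin (2 * π * β) / (4 * π ^ 3 * β ^ 2)
        - (1 / (4 * π ^ 2)) *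
          ∑' n : ℤ, s n / ((n : ℝ) - β) ^ 2 *
            (2 + Real.sin (2 * π * β) / (π * ((n : ℝ) - β))) := by
  obtain ⟨p1, p2⟩ := H0_pair β hβ
  have k1 : Integrable (fun x => H1 (x + β)) := H1_integrable.comp_add_right β
  have k2 := refl_int H1_integrable β
  have k3 : Integrable (fun x => σ * (H1 (x + β) + H1 (-x + β))) := (k1.add k2).const_mul σ
  have eR : (fun x => (H (x + β) + H (-x + β))) =
      fun x => (H0 (x + β) + H0 (-x + β)) + σ * (H1 (x + β) + H1 (-x + β)) := by
    ext x; rw [hH, hH]; ring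
  have iR : Integrable (fun x => (H (x + β) + H (-x + β))) := by
    rw [eR]; exact p1.add k3
  have vR : ∫ x, (H (x + β) + H (-x + β)) = 4 * β + 2 * σ := by
    rw [eR, integral_add p1 k3, p2, integral_const_mul, integral_add k1 k2, refl_integral,
      integral_add_right_eq_self H1, int_H1]; ring
  obtain ⟨q1, q2⟩ := sum_exchange β s hs
  have q3 : Integrable (fun x => H1 x * Jf (x + β)) :=
    bdd_integrable H1_integrable (Jf_meas.comp (by fun_prop)) 2 (fun x => Jf_le _)
  have eQ : (fun x => H1 x * H (x + β)) =
      fun x => (H1 x * ∑' n : ℤ, s n * H1 (x + β - n)) + H1 x * Jf (x + β) := by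
    ext x; rw [hH']; ring
  have iQ : Integrable (fun x => H1 x * H (x + β)) := by
    rw [eQ]; exact q1.add q3
  have vQ : ∫ x, H1 x * H (x + β) = (∑' n : ℤ, s n * ∫ x, H1 x * H1 (x + (β - n)))
      + (1 / (π ^ 2 * β) - Real.sin (2 * π * β) / (2 * π ^ 3 * β ^ 2)) := by
    rw [eQ, integral_add q1 q3, q2.tsum_eq, ← conv_J β hβ.ne']
    rfl
  have iQ' : Integrable (fun x => H1 x * H (-x + β)) := by
    simpa [H1_neg] using iQ.comp_neg
  have vQ' : ∫ x, H1 x * H (-x + β) = ∫ x, H1 x * H (x + β) := by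
    simpa [H1_neg] using integral_neg_eq_self (fun x => H1 x * H (x + β)) volume
  have key : Mpc (fun x => (H (x + β) + H (-x + β)) / 2) =
      (4 * β + 2 * σ) / 2 - ∫ x, H1 x * H (x + β) := by
    have e : (fun x => (H (x + β) + H (-x + β)) / 2 * pairCorKernel x) =
        fun x => (H (x + β) + H (-x + β)) * (1 / 2) - (H1 x * H (x + β) + H1 x * H (-x + β)) * (1 / 2) := by
      ext x; simp only [pairCorKernel, H1]; ring
    have iQQ : Integrable (fun x => H1 x * H (x + β) + H1 x * H (-x + β)) := iQ.add iQ'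
    rw [Mpc, e, integral_sub (iR.mul_const _) (iQQ.mul_const _), integral_mul_const,
      integral_mul_const, integral_add iQ iQ', vQ', vR]
    ring
  have eS : ∀ n : ℤ, s n * ∫ x, H1 x * H1 (x + (β - n)) = (1 / (2 * π ^ 2)) *
      (s n / ((n : ℝ) - β) ^ 2 * (2 + Real.sin (2 * π * β) / (π * ((n : ℝ) - β)))) := by
    intro n
    have h1 : β - n ≠ 0 := sub_ne_zero.2 (hint n)
    rw [conv_H1 _ h1, sin_shift]
    obtain ⟨c, hc⟩ : ∃ c, c = β - n := ⟨_, rfl⟩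
    rw [show (n : ℝ) - β = -c by rw [hc]; ring, ← hc]
    rw [← hc] at h1
    field_simp
    ring
  rw [key, vQ, tsum_congr eS, tsum_mul_left]
  field_simp
  ring

lemma sgn_split (σ : ℝ) (s : ℤ → ℝ) (hs : ∀ n, s n = if n = 0 then σ else (Int.sign n : ℝ)) (y : ℝ) :
    H0 y + σ * H1 y = (∑' n : ℤ, s n * H1 (y - n)) + Jf y := by
  have h1 := (summ y (fun m => (Int.sign m : ℝ)) sign_le).hasSum
  have h2 : HasSum (fun n : ℤ => if n = 0 then σ * H1 y else 0) (σ * H1 y) := hasSum_ite_eq 0 _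
  have h3 := (h1.add h2).tsum_eq
  rw [H0_eq, add_right_comm, ← h3]
  congr 2
  ext n
  rw [hs]
  by_cases h : n = 0 <;> simp [h]

theorem M_of_beurling_selberg (β : ℝ) (hβ : 0 < β) (hint : ∀ n : ℤ, β ≠ (n : ℝ)) :
    (1 / 2) * Mpc (rPlus β) =
      (β + 1 / 2) - 1 / (2 * π ^ 2 * β) + Real.sin (2 * π * β) / (4 * π ^ 3 * β ^ 2)
        - (1 / (4 * π ^ 2)) *
          ∑' n : ℤ, sgnP n / ((n : ℝ) - β) ^ 2 *
            (2 + Real.sin (2 * π * β) / (π * ((n : ℝ) - β))) ∧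
    (1 / 2) * Mpc (rMinus β) =
      (β - 1 / 2) - 1 / (2 * π ^ 2 * β) + Real.sin (2 * π * β) / (4 * π ^ 3 * β ^ 2)
        - (1 / (4 * π ^ 2)) *
          ∑' n : ℤ, sgnM n / ((n : ℝ) - β) ^ 2 *
            (2 + Real.sin (2 * π * β) / (π * ((n : ℝ) - β))) := by

  have hP : ∀ n, |sgnP n| ≤ 1 := fun n => by
    unfold sgnP; split_ifs
    · simp
    · exact sign_le n
  have hM : ∀ n, |sgnM n| ≤ 1 := fun n => by
    unfold sgnM; split_ifs
    · simp
    · exact sign_le n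
  have eP : ∀ y, Hplus y = H0 y + 1 * H1 y := fun y => by rw [Hplus, one_mul]
  have eM : ∀ y, Hminus y = H0 y + (-1) * H1 y := fun y => by rw [Hminus]; ring
  constructor
  · have := general β hβ hint Hplus 1 sgnP hP eP
      (fun y => (eP y).trans (sgn_split 1 sgnP (fun _ => rfl) y))
    rw [one_mul] at this
    exact this
  · have := general β hβ hint Hminus (-1) sgnM hM eM
      (fun y => (eM y).trans (sgn_split (-1) sgnM (fun _ => rfl) y))
    rw [neg_one_mul, ← sub_eq_add_neg] at this
    exact this
end

section
/- Let w ∈ ℂ with 2π²w² ≠ 1. The function z ↦ K(w,z) is entire of exponential type at most π with ∫_ℝ |K(w,x)|² dμ(x) < ∞, and for every entire function F of exponential type at most π satisfying ∫_ℝ |F(x)|² dμ(x) < ∞ one has ∫_ℝ F(x)·conj(K(w,x)) dμ(x) = F(w). That is, K is the reproducing kernel of the Hilbert space of entire functions of exponential type at most π that are square-integrable with respect to μ. -/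
open Filter MeasureTheory Real Complex

/-- The constant `2^{-1/2}`. -/
noncomputable def invSqrt2 : ℝ := (Real.sqrt 2)⁻¹

/-- The entire extension of `sin z / z`. -/
noncomputable def csinc (z : ℂ) : ℂ := if z = 0 then 1 else Complex.sin z / z

/-- The coefficient `c(w)`. -/
noncomputable def cCoef (w : ℂ) : ℂ :=
  (Complex.cos ((π : ℂ) * w) - (π : ℂ) * w * Complex.sin ((π : ℂ) * w)) /
    ((1 - 2 * (π : ℂ) ^ 2 * w ^ 2) *
      ((Real.cos invSqrt2 : ℂ) - (invSqrt2 : ℂ) * (Real.sin invSqrt2 : ℂ)))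

/-- The coefficient `d(w)`. -/
noncomputable def dCoef (w : ℂ) : ℂ :=
  (2 * (π : ℂ) * w * Complex.cos ((π : ℂ) * w)) /
    ((1 - 2 * (π : ℂ) ^ 2 * w ^ 2) * (Real.sqrt 2 : ℂ) * (Real.cos invSqrt2 : ℂ))

/-- `f(w,z) = (2π²w²/(2π²w²−1)) · sin π(z−w)/(π(z−w))` (with the removable singularity at
`z = w` filled in). -/
noncomputable def fFun (w z : ℂ) : ℂ :=
  (2 * (π : ℂ) ^ 2 * w ^ 2 / (2 * (π : ℂ) ^ 2 * w ^ 2 - 1)) * csinc ((π : ℂ) * (z - w))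

/-- The value of `g` at the removable singularities `±1/(π√2)`. -/
noncomputable def gSingVal : ℂ := 1 / 2 + (Real.sin (Real.sqrt 2) / (2 * Real.sqrt 2) : ℝ)

/-- The value of `h` at the removable singularity `1/(π√2)`. -/
noncomputable def hSingVal : ℂ := 1 / 2 - (Real.sin (Real.sqrt 2) / (2 * Real.sqrt 2) : ℝ)

/-- `g(z) = (√2 sin(2^{-1/2}) cos πz − 2πz cos(2^{-1/2}) sin πz)/(1 − 2π²z²)`, with the
removable singularities at `±1/(π√2)` filled in by continuity. -/
noncomputable def gFun (z : ℂ) : ℂ :=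
  if 1 - 2 * (π : ℂ) ^ 2 * z ^ 2 = 0 then gSingVal
  else ((Real.sqrt 2 * Real.sin invSqrt2 : ℝ) * Complex.cos ((π : ℂ) * z)
      - 2 * (π : ℂ) * z * (Real.cos invSqrt2 : ℂ) * Complex.sin ((π : ℂ) * z)) /
    (1 - 2 * (π : ℂ) ^ 2 * z ^ 2)

/-- `h(z) = (2πz sin(2^{-1/2}) cos πz − √2 cos(2^{-1/2}) sin πz)/(1 − 2π²z²)`, with the
removable singularities at `±1/(π√2)` filled in by continuity. -/
noncomputable def hFun (z : ℂ) : ℂ :=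
  if z = ((π * Real.sqrt 2)⁻¹ : ℝ) then hSingVal
  else if z = -((π * Real.sqrt 2)⁻¹ : ℝ) then -hSingVal
  else (2 * (π : ℂ) * z * (Real.sin invSqrt2 : ℂ) * Complex.cos ((π : ℂ) * z)
      - (Real.sqrt 2 * Real.cos invSqrt2 : ℝ) * Complex.sin ((π : ℂ) * z)) /
    (1 - 2 * (π : ℂ) ^ 2 * z ^ 2)

/-- The reproducing kernel `K(w,z) = f(w̄,z) + c(w̄) g(z) + d(w̄) h(z)` for the pair
correlation measure. -/
noncomputable def Kker (w z : ℂ) : ℂ :=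
  fFun ((starRingEnd ℂ) w) z + cCoef ((starRingEnd ℂ) w) * gFun z
    + dCoef ((starRingEnd ℂ) w) * hFun z

/-- The pair correlation measure `dμ(x) = {1 - (sin πx/(πx))²} dx`. -/
noncomputable def pairCorMeasure : Measure ℝ :=
  volume.withDensity fun x => ENNReal.ofReal (pairCorKernel x)

/-- An entire function has exponential type at most `τ`. -/
def HasExpTypeLE (F : ℂ → ℂ) (τ : ℝ) : Prop :=
  ∀ ε > 0, ∃ C > 0, ∀ z : ℂ, ‖F z‖ ≤ C * Real.exp ((τ + ε) * ‖z‖)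


lemma strip_shift (Q : ℂ → ℂ) (a b N : ℝ) (hab : a ≤ b)
    (hd : DifferentiableOn ℂ Q {z | z.im ∈ Set.Icc a b})
    (hi : ∀ y ∈ Set.Icc a b, Integrable (fun x : ℝ => Q (x + y * I)))
    (hN : ∀ y ∈ Set.Icc a b, ∫ x : ℝ, ‖Q (x + y * I)‖ ≤ N) :
    ∫ x : ℝ, Q (x + a * I) = ∫ x : ℝ, Q (x + b * I) := by
  have hcont : ContinuousOn (fun q : ℝ × ℝ => Q (q.2 + q.1 * I)) (Set.Icc a b ×ˢ Set.univ) := by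
    apply hd.continuousOn.comp (f := fun q : ℝ × ℝ => (q.2 + q.1 * I : ℂ))
    · fun_prop
    · rintro ⟨y, x⟩ ⟨hy, -⟩
      simpa using hy
  have hmeas : AEStronglyMeasurable (fun q : ℝ × ℝ => Q (q.2 + q.1 * I))
      ((volume.restrict (Set.Icc a b)).prod volume) := by
    have := hcont.aestronglyMeasurable (μ := (volume : Measure (ℝ × ℝ)))
      (measurableSet_Icc.prod MeasurableSet.univ)
    rw [Measure.volume_eq_prod, ← Measure.prod_restrict, Measure.restrict_univ] at this
    exact this
  have hint : Integrable (fun q : ℝ × ℝ => Q (q.2 + q.1 * I))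
      ((volume.restrict (Set.Icc a b)).prod volume) := by
    rw [integrable_prod_iff hmeas]
    refine ⟨?_, ?_⟩
    · filter_upwards [ae_restrict_mem measurableSet_Icc] with y hy using hi y hy
    · refine Integrable.mono' (g := fun _ => N) (integrable_const N) ?_ ?_
      · exact hmeas.norm.integral_prod_right'
      · filter_upwards [ae_restrict_mem measurableSet_Icc] with y hy
        rw [Real.norm_of_nonneg (integral_nonneg fun _ => norm_nonneg _)]
        exact hN y hy
  have hr : Integrable (fun x : ℝ => ∫ y in a..b, Q (x + y * I)) := by
    have := hint.integral_prod_right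
    refine this.congr (Eventually.of_forall fun x => ?_)
    simp only
    rw [intervalIntegral.integral_of_le hab, integral_Icc_eq_integral_Ioc]
  have hrect : ∀ R : ℝ, (∫ x in (-R)..R, Q (x + a * I)) - (∫ x in (-R)..R, Q (x + b * I))
      = I * (∫ y in a..b, Q ((-R : ℝ) + y * I)) - I * (∫ y in a..b, Q (R + y * I)) := by
    intro R
    have := integral_boundary_rect_eq_zero_of_differentiableOn Q (-R + a * I) (R + b * I)
      (hd.mono (by
        intro z hz
        have := hz.2
        simpa [Set.uIcc_of_le hab] using this))
    simp only [add_re, neg_re, ofReal_re, mul_re, I_re, mul_zero, ofReal_im, I_im, mul_one,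
      sub_self, add_zero, add_im, neg_im, neg_zero, mul_im, zero_add, smul_eq_mul] at this
    linear_combination this
  have ht : Tendsto (fun R : ℝ => (∫ x in (-R)..R, Q (x + a * I)) - (∫ x in (-R)..R, Q (x + b * I)))
      atTop (nhds ((∫ x : ℝ, Q (x + a * I)) - ∫ x : ℝ, Q (x + b * I))) := by
    apply Tendsto.sub
    · exact intervalIntegral_tendsto_integral (hi a ⟨le_rfl, hab⟩) tendsto_neg_atTop_atBot tendsto_id
    · exact intervalIntegral_tendsto_integral (hi b ⟨hab, le_rfl⟩) tendsto_neg_atTop_atBot tendsto_id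
  have hg : Integrable (fun R : ℝ => (∫ x in (-R)..R, Q (x + a * I)) - (∫ x in (-R)..R, Q (x + b * I))) := by
    simp_rw [hrect]
    exact (hr.comp_neg.const_mul I).sub (hr.const_mul I)
  have := IntegrableAtFilter.eq_zero_of_tendsto (hg.integrableAtFilter atTop) (by
    intro s hs
    rcases mem_atTop_sets.1 hs with ⟨b, hb⟩
    rw [← top_le_iff, ← volume_Ici (a := b)]
    exact measure_mono hb) ht
  exact sub_eq_zero.1 this

lemma pl_upper (H : ℂ → ℂ) (hd : Differentiable ℂ H) (τ B : ℝ) 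
    (hexp : ∀ ε > 0, ∃ C > 0, ∀ z : ℂ, ‖H z‖ ≤ C * Real.exp ((τ + ε) * ‖z‖))
    (hB : ∀ x : ℝ, ‖H x‖ ≤ B) (y : ℝ) (hy : 0 ≤ y) : ‖H (y * I)‖ ≤ B * Real.exp (τ * y) := by
  have key : ∀ ε > 0, ‖H (y * I)‖ ≤ B * Real.exp ((τ + ε) * y) := by
    intro ε hε
    obtain ⟨C, hC, hCb⟩ := hexp ε hε
    have h := PhragmenLindelof.right_half_plane_of_bounded_on_real (C := B) (z := (y : ℂ))
      (f := fun z => H (z * I) * Complex.exp (-((τ + ε : ℝ) : ℂ) * z)) ?_ ?_ ?_ ?_ (by simpa using hy)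
    · simp only [norm_mul, Complex.norm_exp] at h
      have h2 : (-((τ + ε : ℝ) : ℂ) * (y : ℂ)).re = -((τ + ε) * y) := by
        simp [← ofReal_mul, -ofReal_add]
      rw [h2, Real.exp_neg, ← div_eq_mul_inv, div_le_iff₀ (Real.exp_pos _)] at h
      exact h
    · apply Differentiable.diffContOnCl
      fun_prop
    · refine ⟨1, by norm_num, (τ + ε) + |τ + ε|, ?_⟩
      apply Asymptotics.IsBigO.of_bound C
      refine Eventually.of_forall fun z => ?_
      rw [norm_mul, Complex.norm_exp, Real.norm_of_nonneg (Real.exp_pos _).le, Real.rpow_one, add_mul,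
        Real.exp_add, ← mul_assoc]
      gcongr
      · simpa using hCb (z * I)
      · have h1 := Complex.abs_re_le_norm z
        calc (-((τ + ε : ℝ) : ℂ) * z).re = -(τ + ε) * z.re := by simp [-ofReal_add, ← ofReal_neg]
          _ ≤ |-(τ + ε) * z.re| := le_abs_self _
          _ = |τ + ε| * |z.re| := by rw [abs_mul, abs_neg]
          _ ≤ _ := by gcongr
    · refine isBoundedUnder_of_eventually_le (a := C) ?_
      filter_upwards [eventually_ge_atTop 0] with x hx
      rw [norm_mul, Complex.norm_exp]
      have h2 : (-((τ + ε : ℝ) : ℂ) * (x : ℂ)).re = -((τ + ε) * x) := by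
        simp [← ofReal_mul, -ofReal_add]
      rw [h2, Real.exp_neg, ← div_eq_mul_inv, div_le_iff₀ (Real.exp_pos _)]
      simpa [abs_of_nonneg hx] using hCb (x * I)
    · intro x
      rw [norm_mul, Complex.norm_exp]
      have h1 : (-((τ + ε : ℝ) : ℂ) * (x * I)).re = 0 := by
        simp
      have h2 : (x * I * I : ℂ) = ((-x : ℝ) : ℂ) := by
        rw [mul_assoc, I_mul_I]; push_cast; ring
      rw [h1, Real.exp_zero, mul_one, h2]
      exact hB _
  have ht : Tendsto (fun ε : ℝ => B * Real.exp ((τ + ε) * y)) (nhdsWithin 0 (Set.Ioi 0))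
      (nhds (B * Real.exp (τ * y))) := by
    refine Tendsto.mono_left ?_ nhdsWithin_le_nhds
    exact Continuous.tendsto' (by fun_prop) _ _ (by simp)
  exact ge_of_tendsto ht (by filter_upwards [self_mem_nhdsWithin] with ε hε using key ε hε)

lemma pl_both (H : ℂ → ℂ) (hd : Differentiable ℂ H) (τ B : ℝ) 
    (hexp : ∀ ε > 0, ∃ C > 0, ∀ z : ℂ, ‖H z‖ ≤ C * Real.exp ((τ + ε) * ‖z‖))
    (hB : ∀ x : ℝ, ‖H x‖ ≤ B) (y : ℝ) : ‖H (y * I)‖ ≤ B * Real.exp (τ * |y|) := by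
  rcases le_total 0 y with hy | hy
  · rw [abs_of_nonneg hy]; exact pl_upper H hd τ B hexp hB y hy
  · rw [abs_of_nonpos hy]
    have := pl_upper (fun z => H (-z)) (by fun_prop) τ B ?_ ?_ (-y) (by linarith)
    · simpa using this
    · intro ε hε
      obtain ⟨C, hC, h⟩ := hexp ε hε
      exact ⟨C, hC, fun z => by simpa using h (-z)⟩
    · intro x
      simpa using hB (-x)

lemma diff_conv (F : ℂ → ℂ) (hF : Differentiable ℂ F) (k : ℝ → ℂ) (hk : Continuous k) (a b : ℝ) :
    Differentiable ℂ (fun z : ℂ => ∫ t in a..b, F (z + t) * k t) := by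
  intro z₀
  have hdF : Continuous (deriv F) := (hF.contDiff (n := 1)).continuous_deriv le_rfl
  have hFc := hF.continuous
  have hc : Continuous (fun q : ℂ × ℝ => deriv F (q.1 + q.2) * k q.2) := by fun_prop
  obtain ⟨D, hD⟩ := ((isCompact_closedBall z₀ 1).prod (isCompact_uIcc (a := a) (b := b))).exists_bound_of_continuousOn
    hc.continuousOn
  have := (intervalIntegral.hasDerivAt_integral_of_dominated_loc_of_deriv_le (μ := volume) (a := a) (b := b)
    (F := fun z t => F (z + t) * k t) (F' := fun z t => deriv F (z + t) * k t) (x₀ := z₀)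
    (s := Metric.closedBall z₀ 1) (bound := fun _ => D)
    (Metric.closedBall_mem_nhds _ one_pos) ?_ ?_ ?_ ?_ ?_ ?_).2
  · exact this.differentiableAt
  · refine Eventually.of_forall fun z => ?_
    exact (Continuous.aestronglyMeasurable (by fun_prop))
  · exact Continuous.intervalIntegrable (by fun_prop) _ _
  · exact (Continuous.aestronglyMeasurable (by fun_prop))
  · refine Eventually.of_forall fun t ht z hz => ?_
    exact hD (z, t) ⟨hz, Set.uIoc_subset_uIcc ht⟩
  · exact intervalIntegrable_const
  · refine Eventually.of_forall fun t ht z hz => ?_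
    have h1 : HasDerivAt (fun z : ℂ => F (z + t)) (deriv F (z + t)) z :=
      (hF (z + t)).hasDerivAt.comp_add_const z (t : ℂ)
    exact h1.mul_const _

lemma pp_aux (F : ℂ → ℂ) (hF : Differentiable ℂ F) 
    (hexp : ∀ ε > 0, ∃ C > 0, ∀ z : ℂ, ‖F z‖ ≤ C * Real.exp ((π + ε) * ‖z‖))
    (hL : Integrable (fun x : ℝ => ‖F x‖ ^ 2)) (y R : ℝ) (hR : 0 ≤ R) :
    ∫ t in (-R)..R, ‖F (t + y * I)‖ ^ 2 ≤ Real.exp (2 * π * |y|) * ∫ x : ℝ, ‖F x‖ ^ 2 := by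
  have hFc := hF.continuous
  set k : ℝ → ℂ := fun t => (starRingEnd ℂ) (F (t + y * I)) with hkdef
  have hk : Continuous k := by
    apply Complex.continuous_conj.comp; fun_prop
  set N := ∫ t in (-R)..R, ‖F (t + y * I)‖ ^ 2 with hN
  set A := ∫ x : ℝ, ‖F x‖ ^ 2 with hA
  set s := Real.exp (π * |y|) with hs
  have hspos : 0 < s := Real.exp_pos _
  set H : ℂ → ℂ := fun z : ℂ => ∫ t in (-R)..R, F (z + t) * k t with hH
  have hkn : ∀ t, ‖k t‖ = ‖F (t + y * I)‖ := fun t => by simp [hkdef]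
  have hHd : Differentiable ℂ H := diff_conv F hF k hk _ _
  obtain ⟨D, hD⟩ := (isCompact_uIcc (a := -R) (b := R)).exists_bound_of_continuousOn hk.continuousOn
  have hHexp : ∀ ε > 0, ∃ C > 0, ∀ z : ℂ, ‖H z‖ ≤ C * Real.exp ((π + ε) * ‖z‖) := by
    intro ε hε
    obtain ⟨C, hC, hCb⟩ := hexp ε hε
    have hD0 : 0 ≤ D := (norm_nonneg _).trans (hD 0 (by simp [hR]))
    refine ⟨C * Real.exp ((π + ε) * R) * D * |R - -R| + 1, by positivity, fun z => ?_⟩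
    have : ‖H z‖ ≤ (C * Real.exp ((π + ε) * (‖z‖ + R)) * D) * |R - -R| := by
      apply intervalIntegral.norm_integral_le_of_norm_le_const
      intro t ht
      have ht' := Set.uIoc_subset_uIcc ht
      rw [norm_mul]
      have h1 : ‖z + t‖ ≤ ‖z‖ + R := by
        refine (norm_add_le _ _).trans ?_
        rw [Set.uIcc_of_le (by linarith)] at ht'
        have : ‖(t : ℂ)‖ ≤ R := by
          rw [Complex.norm_real, Real.norm_eq_abs]; exact abs_le.2 ht'
        linarith
      have hπ := Real.pi_pos
      refine mul_le_mul ((hCb _).trans ?_) (hD t ht') (norm_nonneg _) (by positivity)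
      gcongr
    refine this.trans ?_
    have he : Real.exp ((π + ε) * (‖z‖ + R)) = Real.exp ((π + ε) * ‖z‖) * Real.exp ((π + ε) * R) := by
      rw [← Real.exp_add]; ring_nf
    rw [he]
    have := Real.exp_pos ((π + ε) * ‖z‖)
    nlinarith
  have hHB : ∀ x : ℝ, ‖H x‖ ≤ (s * A + s⁻¹ * N) / 2 := by
    intro x
    have hi1 : IntervalIntegrable (fun t : ℝ => ‖F (x + t)‖ ^ 2) volume (-R) R :=
      Continuous.intervalIntegrable (by fun_prop) _ _
    have hi2 : IntervalIntegrable (fun t : ℝ => ‖F (t + y * I)‖ ^ 2) volume (-R) R :=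
      Continuous.intervalIntegrable (by fun_prop) _ _
    have h1 : ‖H x‖ ≤ ∫ t in (-R)..R, (s / 2 * ‖F (x + t)‖ ^ 2 + s⁻¹ / 2 * ‖F (t + y * I)‖ ^ 2) := by
      apply intervalIntegral.norm_integral_le_of_norm_le (by linarith)
      · refine Eventually.of_forall fun t ht => ?_
        rw [norm_mul, hkn]
        have := sq_nonneg (s * ‖F (x + t)‖ - ‖F (t + y * I)‖)
        have h2 : s / 2 * ‖F (x + t)‖ ^ 2 + s⁻¹ / 2 * ‖F (t + y * I)‖ ^ 2 - ‖F (x + t)‖ * ‖F (t + y * I)‖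
          = s⁻¹ / 2 * (s * ‖F (x + t)‖ - ‖F (t + y * I)‖) ^ 2 := by
            field_simp
            ring
        have h3 : 0 ≤ s⁻¹ / 2 * (s * ‖F (x + t)‖ - ‖F (t + y * I)‖) ^ 2 := by positivity
        linarith
      · exact (hi1.const_mul _).add (hi2.const_mul _)
    rw [intervalIntegral.integral_add (hi1.const_mul _) (hi2.const_mul _),
      intervalIntegral.integral_const_mul, intervalIntegral.integral_const_mul, ← hN] at h1
    have h4 : ∫ t in (-R)..R, ‖F (x + t)‖ ^ 2 ≤ A := by
      have : ∫ t in (-R)..R, ‖F (x + t)‖ ^ 2 = ∫ t in (x + -R)..(x + R), ‖F t‖ ^ 2 := by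
        rw [← intervalIntegral.integral_comp_add_left]
        simp
      rw [this, intervalIntegral.integral_of_le (by linarith)]
      exact setIntegral_le_integral hL (Eventually.of_forall fun _ => by positivity)
    nlinarith
  have hfin := pl_both H hHd π _ hHexp hHB y
  have hHy : H (y * I) = (N : ℂ) := by
    rw [hN, ← intervalIntegral.integral_ofReal]
    apply intervalIntegral.integral_congr
    intro t _
    simp only [hkdef]
    rw [add_comm (y * I : ℂ), Complex.mul_conj, Complex.normSq_eq_norm_sq]
  rw [hHy, Complex.norm_real, Real.norm_eq_abs, ← hs] at hfin
  have h5 := (le_abs_self N).trans hfin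
  have h6 : (s * A + s⁻¹ * N) / 2 * s = s ^ 2 * A / 2 + N / 2 := by
    field_simp
  have h7 : Real.exp (2 * π * |y|) = s ^ 2 := by
    rw [hs, ← Real.exp_nat_mul]; push_cast; ring_nf
  rw [h7]
  linarith

lemma pp (F : ℂ → ℂ) (hF : Differentiable ℂ F) 
    (hexp : ∀ ε > 0, ∃ C > 0, ∀ z : ℂ, ‖F z‖ ≤ C * Real.exp ((π + ε) * ‖z‖))
    (hL : Integrable (fun x : ℝ => ‖F x‖ ^ 2)) (y : ℝ) :
    Integrable (fun x : ℝ => ‖F (x + y * I)‖ ^ 2) ∧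
    ∫ x : ℝ, ‖F (x + y * I)‖ ^ 2 ≤ Real.exp (2 * π * |y|) * ∫ x : ℝ, ‖F x‖ ^ 2 := by
  have hFc := hF.continuous
  have hi : Integrable (fun x : ℝ => ‖F (x + y * I)‖ ^ 2) := by
    refine integrable_of_intervalIntegral_norm_bounded (l := atTop) (a := fun R : ℝ => -R) (b := fun R => R)
      (Real.exp (2 * π * |y|) * ∫ x : ℝ, ‖F x‖ ^ 2) ?_ tendsto_neg_atTop_atBot tendsto_id ?_
    · intro R
      exact (Continuous.integrableOn_Ioc (by fun_prop))
    · filter_upwards [eventually_ge_atTop 0] with R hR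
      simpa using pp_aux F hF hexp hL y R hR
  refine ⟨hi, ?_⟩
  refine le_of_tendsto (intervalIntegral_tendsto_integral hi tendsto_neg_atTop_atBot tendsto_id) ?_
  filter_upwards [eventually_ge_atTop 0] with R hR
  exact pp_aux F hF hexp hL y R hR

/-- Hardy-type condition on the closed upper half plane. -/
structure H2U (E : ℂ → ℂ) (M : ℝ) : Prop where
  diff : Differentiable ℂ E
  int : ∀ y : ℝ, 0 ≤ y → Integrable (fun x : ℝ => ‖E (x + y * I)‖ ^ 2)
  bd : ∀ y : ℝ, 0 ≤ y → ∫ x : ℝ, ‖E (x + y * I)‖ ^ 2 ≤ M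

lemma poisson (a b : ℝ) (hb : 0 < b) : Integrable (fun x : ℝ => ((x - a) ^ 2 + b ^ 2)⁻¹) ∧
    ∫ x : ℝ, ((x - a) ^ 2 + b ^ 2)⁻¹ = π / b := by
  have h : (fun x : ℝ => ((x - a) ^ 2 + b ^ 2)⁻¹) =
      fun x => (b ^ 2)⁻¹ * (1 + ((x - a) / b) ^ 2)⁻¹ := by
    funext x
    rw [← mul_inv]
    congr 1
    field_simp
    ring
  have hi : Integrable (fun x : ℝ => (1 + ((x - a) / b) ^ 2)⁻¹) :=
    (integrable_inv_one_add_sq.comp_div hb.ne').comp_sub_right a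
  rw [h]
  refine ⟨hi.const_mul _, ?_⟩
  rw [integral_const_mul, integral_sub_right_eq_self (fun x => (1 + (x / b) ^ 2)⁻¹) a,
    Measure.integral_comp_div (fun x : ℝ => (1 + x ^ 2)⁻¹) b, integral_univ_inv_one_add_sq,
    abs_of_pos hb, smul_eq_mul]
  field_simp

lemma norm_line (p : ℂ) (x y : ℝ) :
    (‖(x + y * I : ℂ) - p‖⁻¹) ^ 2 = ((x - p.re) ^ 2 + (|y - p.im|) ^ 2)⁻¹ := by
  rw [inv_pow, Complex.sq_norm, Complex.normSq_apply, sq_abs]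
  simp
  ring

lemma kernel_line (p : ℂ) (y : ℝ) (hy : y ≠ p.im) :
    Integrable (fun x : ℝ => (‖(x + y * I : ℂ) - p‖⁻¹) ^ 2) ∧
    ∫ x : ℝ, (‖(x + y * I : ℂ) - p‖⁻¹) ^ 2 = π / |y - p.im| := by
  simp_rw [norm_line]
  exact poisson _ _ (abs_pos.2 (sub_ne_zero.2 hy))

lemma amgm (a b η : ℝ) (hη : 0 < η) : a * b ≤ η * a ^ 2 + η⁻¹ * b ^ 2 := by
  have h : η * a ^ 2 + η⁻¹ * b ^ 2 - a * b = η⁻¹ * ((η * a - b / 2) ^ 2 + 3 / 4 * b ^ 2) := by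
    field_simp
    ring
  have : 0 ≤ η⁻¹ * ((η * a - b / 2) ^ 2 + 3 / 4 * b ^ 2) := by positivity
  linarith

lemma hardy0 {E : ℂ → ℂ} {M : ℝ} (hE : H2U E M) (p : ℂ) (hp : p.im < 0) (Q : ℂ → ℂ)
    (hQ : DifferentiableOn ℂ Q {z | 0 ≤ z.im}) (C : ℝ) (hC : 0 ≤ C)
    (hb : ∀ z : ℂ, 0 ≤ z.im → ‖Q z‖ ≤ C * ((‖E z‖ + ‖z - p‖⁻¹) * ‖z - p‖⁻¹)) :
    ∫ x : ℝ, Q x = 0 := by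
  have hbd : ∀ η > 0, ∀ y : ℝ, 0 ≤ y → ∀ x : ℝ, ‖Q (x + y * I)‖ ≤
      C * (η * ‖E (x + y * I)‖ ^ 2 + (η⁻¹ + 1) * (‖(x + y * I : ℂ) - p‖⁻¹) ^ 2) := by
    intro η hη y hy x
    refine (hb (x + y * I) (by simpa using hy)).trans ?_
    have := amgm ‖E (x + y * I)‖ (‖(x + y * I : ℂ) - p‖⁻¹) η hη
    gcongr
    linarith
  have hdi : ∀ η > 0, ∀ y : ℝ, 0 ≤ y → Integrable (fun x : ℝ => 
      C * (η * ‖E (x + y * I)‖ ^ 2 + (η⁻¹ + 1) * (‖(x + y * I : ℂ) - p‖⁻¹) ^ 2)) := by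
    intro η hη y hy
    exact (((hE.int y hy).const_mul _).add ((kernel_line p y (by linarith)).1.const_mul _)).const_mul _
  have hi : ∀ y : ℝ, 0 ≤ y → Integrable (fun x : ℝ => Q (x + y * I)) := by
    intro y hy
    refine (hdi 1 one_pos y hy).mono' ?_ (Eventually.of_forall (hbd 1 one_pos y hy))
    apply Continuous.aestronglyMeasurable
    refine hQ.continuousOn.comp_continuous (by fun_prop) ?_
    intro x
    simpa using hy
  have hN : ∀ η > 0, ∀ y : ℝ, 0 ≤ y → ∫ x : ℝ, ‖Q (x + y * I)‖ ≤
      C * (η * M + (η⁻¹ + 1) * (π / (y - p.im))) := by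
    intro η hη y hy
    refine (integral_mono (hi y hy).norm (hdi η hη y hy) (hbd η hη y hy)).trans ?_
    have hk := kernel_line p y (by linarith)
    rw [integral_const_mul, integral_add ((hE.int y hy).const_mul _) (hk.1.const_mul _),
      integral_const_mul, integral_const_mul, hk.2, abs_of_pos (by linarith)]
    have := hE.bd y hy
    gcongr
  have hshift : ∀ y : ℝ, 0 ≤ y → ∫ x : ℝ, Q x = ∫ x : ℝ, Q (x + y * I) := by
    intro y hy
    have := strip_shift Q 0 y (C * (1 * M + (1⁻¹ + 1) * (π / (0 - p.im)))) hy
      (hQ.mono fun z hz => hz.1) (fun t ht => hi t ht.1) ?_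
    · simpa using this
    · intro t ht
      refine (hN 1 one_pos t ht.1).trans ?_
      have := Real.pi_pos
      gcongr
      exact ht.1
  have h1 : ∀ η > 0, ‖∫ x : ℝ, Q x‖ ≤ C * (η * M + (η⁻¹ + 1) * 0) := by
    intro η hη
    have ht : Tendsto (fun y : ℝ => C * (η * M + (η⁻¹ + 1) * (π / (y - p.im)))) atTop
        (nhds (C * (η * M + (η⁻¹ + 1) * 0))) := by
      apply Tendsto.const_mul
      apply Tendsto.const_add
      apply Tendsto.const_mul
      apply Tendsto.const_div_atTop
      exact tendsto_atTop_add_const_right _ _ tendsto_id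
    refine ge_of_tendsto ht ?_
    filter_upwards [eventually_ge_atTop 0] with y hy
    rw [hshift y hy]
    exact (norm_integral_le_integral_norm _).trans (hN η hη y hy)
  have h2 : ‖∫ x : ℝ, Q x‖ ≤ 0 := by
    have ht : Tendsto (fun η : ℝ => C * (η * M + (η⁻¹ + 1) * 0)) (nhdsWithin 0 (Set.Ioi 0))
        (nhds 0) := by
      refine Tendsto.mono_left ?_ nhdsWithin_le_nhds
      simp only [mul_zero, add_zero]
      exact Continuous.tendsto' (by fun_prop) _ _ (by simp)
    exact ge_of_tendsto ht (by filter_upwards [self_mem_nhdsWithin] with ε hε using h1 ε hε)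
  exact norm_le_zero_iff.1 h2

lemma real_sub_ne {p : ℂ} (hp : p.im ≠ 0) (x : ℝ) : (x : ℂ) - p ≠ 0 := by
  intro h
  apply hp
  have := congrArg Complex.im h
  simpa using this

lemma kernel_int {E : ℂ → ℂ} {M : ℝ} (hE : H2U E M) (p : ℂ) (hp : p.im ≠ 0) :
    Integrable (fun x : ℝ => E x / (x - p)) := by
  have h0 := hE.int 0 le_rfl
  have h1 := (kernel_line p 0 hp.symm).1
  simp only [ofReal_zero, zero_mul, add_zero] at h0 h1
  have hEc := hE.diff.continuous
  refine (h0.add h1).mono' ?_ ?_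
  · apply Continuous.aestronglyMeasurable
    exact Continuous.div (by fun_prop) (by fun_prop) (real_sub_ne hp)
  · refine Eventually.of_forall fun x => ?_
    rw [div_eq_mul_inv, norm_mul, norm_inv]
    have := amgm ‖E x‖ (‖(x : ℂ) - p‖⁻¹) 1 one_pos
    simpa using this

lemma cauchy_out {E : ℂ → ℂ} {M : ℝ} (hE : H2U E M) (p : ℂ) (hp : p.im < 0) :
    ∫ x : ℝ, E x / (x - p) = 0 := by
  refine hardy0 hE p hp (fun z => E z / (z - p)) ?_ 1 zero_le_one ?_
  · apply DifferentiableOn.div hE.diff.differentiableOn (by fun_prop)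
    intro z hz h
    rw [sub_eq_zero] at h
    subst h
    exact absurd hz (not_le.2 hp)
  · intro z hz
    rw [div_eq_mul_inv, norm_mul, norm_inv, one_mul]
    gcongr
    have : 0 ≤ ‖z - p‖⁻¹ := by positivity
    linarith

lemma cauchy_in {E : ℂ → ℂ} {M : ℝ} (hE : H2U E M) (p : ℂ) (hp : 0 < p.im) :
    ∫ x : ℝ, E x / (x - p) = 2 * π * I * E p := by
  set p' := (starRingEnd ℂ) p with hp'
  have hp'im : p'.im < 0 := by simpa [hp'] using hp
  have hdd : Differentiable ℂ (dslope E p) := by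
    rw [← differentiableOn_univ, Complex.differentiableOn_dslope Filter.univ_mem]
    exact hE.diff.differentiableOn
  obtain ⟨D, hD⟩ := (isCompact_closedBall p 1).exists_bound_of_continuousOn hdd.continuous.continuousOn
  have hD0 : 0 ≤ D := (norm_nonneg _).trans (hD p (by simp))
  set L := 1 + ‖p - p'‖ with hL
  have hL1 : 1 ≤ L := by have := norm_nonneg (p - p'); linarith
  have hne : ∀ z : ℂ, 0 ≤ z.im → z - p' ≠ 0 := by
    intro z hz h
    rw [sub_eq_zero] at h
    subst h
    exact absurd hz (not_le.2 hp'im)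
  have hQ0 : ∫ x : ℝ, dslope E p x / (x - p') = 0 := by
    refine hardy0 hE p' hp'im (fun z => dslope E p z / (z - p')) ?_ (L * (1 + D + ‖E p‖)) (by positivity) ?_
    · exact DifferentiableOn.div hdd.differentiableOn (by fun_prop) hne
    · intro z hz
      rw [div_eq_mul_inv, norm_mul, norm_inv, ← mul_assoc]
      have hzp := norm_pos_iff.2 (hne z hz)
      gcongr
      have hg : ‖dslope E p z‖ ≤ L * (D + ‖E p‖) * ‖z - p'‖⁻¹ + L * ‖E z‖ := by
        by_cases h : ‖z - p‖ ≤ 1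
        · have h1 := hD z (by simpa [dist_eq_norm] using h)
          have h2 : ‖z - p'‖ ≤ L := by
            calc ‖z - p'‖ = ‖(z - p) + (p - p')‖ := by ring_nf
              _ ≤ _ := norm_add_le _ _
              _ ≤ _ := by linarith
          have h3 : 1 ≤ L * ‖z - p'‖⁻¹ := by
            rw [← div_eq_mul_inv, le_div_iff₀ hzp]; linarith
          calc ‖dslope E p z‖ ≤ D + ‖E p‖ := by have := norm_nonneg (E p); linarith
            _ ≤ (D + ‖E p‖) * (L * ‖z - p'‖⁻¹) := by
              apply le_mul_of_one_le_right (by positivity) h3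
            _ = L * (D + ‖E p‖) * ‖z - p'‖⁻¹ := by ring
            _ ≤ _ := by
              have : 0 ≤ L * ‖E z‖ := by positivity
              linarith
        · push Not at h
          have hzne : z ≠ p := by
            rintro rfl; simp at h; linarith
          have h2 : ‖z - p'‖ ≤ L * ‖z - p‖ := by
            calc ‖z - p'‖ = ‖(z - p) + (p - p')‖ := by ring_nf
              _ ≤ _ := norm_add_le _ _
              _ ≤ _ := by have := norm_nonneg (p - p'); nlinarith
          have hzp2 : 0 < ‖z - p‖ := by linarith
          have h3 : ‖z - p‖⁻¹ ≤ L * ‖z - p'‖⁻¹ := by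
            rw [← div_eq_mul_inv, le_div_iff₀ hzp, inv_mul_le_iff₀ hzp2]
            linarith
          rw [dslope_of_ne _ hzne, slope_def_field, norm_div, div_eq_mul_inv]
          have h4 : ‖z - p‖⁻¹ ≤ L := (inv_le_one_of_one_le₀ h.le).trans hL1
          calc ‖E z - E p‖ * ‖z - p‖⁻¹ ≤ (‖E z‖ + ‖E p‖) * ‖z - p‖⁻¹ := by
                gcongr
                exact norm_sub_le _ _
            _ = ‖E p‖ * ‖z - p‖⁻¹ + ‖E z‖ * ‖z - p‖⁻¹ := by ring
            _ ≤ ‖E p‖ * (L * ‖z - p'‖⁻¹) + ‖E z‖ * L := by gcongr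
            _ = L * ‖E p‖ * ‖z - p'‖⁻¹ + L * ‖E z‖ := by ring
            _ ≤ _ := by gcongr; linarith
      refine hg.trans ?_
      have e1 : 0 ≤ L * ‖z - p'‖⁻¹ := by positivity
      have e2 : 0 ≤ L * (D + ‖E p‖) * ‖E z‖ := by positivity
      nlinarith
  have hid : ∀ x : ℝ, (p - p') * (dslope E p x / (x - p')) =
      E x / (x - p) - E x / (x - p') - E p * (2 * p.im * I) * (((x - p.re) ^ 2 + p.im ^ 2)⁻¹ : ℝ) := by
    intro x
    have h1 := real_sub_ne hp.ne' x
    have h2 := real_sub_ne hp'im.ne x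
    have h3 : (((x - p.re) ^ 2 + p.im ^ 2 : ℝ) : ℂ) = (x - p) * (x - p') := by
      rw [show (x : ℂ) - p' = (starRingEnd ℂ) (x - p) by simp [hp'], Complex.mul_conj,
        Complex.normSq_apply]
      simp
      ring
    have h4 : p - p' = 2 * p.im * I := by
      rw [hp', Complex.sub_conj]; push_cast; ring
    rw [Complex.ofReal_inv, h3, ← h4, dslope_of_ne _ (sub_ne_zero.1 h1), slope_def_field]
    field_simp
    ring
  have hP := poisson p.re p.im hp
  have h5 : ∫ x : ℝ, (p - p') * (dslope E p x / (x - p')) = 0 := by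
    rw [integral_const_mul, hQ0, mul_zero]
  have hPi : Integrable (fun x : ℝ => E p * (2 * p.im * I) * (((x - p.re) ^ 2 + p.im ^ 2)⁻¹ : ℝ)) :=
    hP.1.ofReal.const_mul _
  simp_rw [hid] at h5
  have hsub : Integrable (fun x : ℝ => E x / (x - p) - E x / (x - p')) :=
    (kernel_int hE p hp.ne').sub (kernel_int hE p' hp'im.ne)
  rw [integral_sub hsub hPi,
    integral_sub (kernel_int hE p hp.ne') (kernel_int hE p' hp'im.ne), cauchy_out hE p' hp'im,
    integral_const_mul, integral_complex_ofReal, hP.2] at h5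
  have h6 : (p.im : ℂ) ≠ 0 := by exact_mod_cast hp.ne'
  have h7 : E p * (2 * p.im * I) * ((π / p.im : ℝ) : ℂ) = 2 * π * I * E p := by
    push_cast
    field_simp
  rw [h7] at h5
  linear_combination h5

lemma cauchy_deriv {E : ℂ → ℂ} {M : ℝ} (hE : H2U E M) (p : ℂ) (hp : p.im ≠ 0) :
    Integrable (fun x : ℝ => E x / (x - p) ^ 2) ∧
    HasDerivAt (fun q : ℂ => ∫ x : ℝ, E x / (x - q)) (∫ x : ℝ, E x / (x - p) ^ 2) p := by
  have hEc := hE.diff.continuous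
  have hpos : 0 < |p.im| := abs_pos.2 hp
  have hnear : ∀ q ∈ Metric.ball p (|p.im| / 2), q.im ≠ 0 := by
    intro q hq h
    rw [Metric.mem_ball, dist_eq_norm] at hq
    have := (Complex.abs_im_le_norm (q - p)).trans_lt hq
    rw [Complex.sub_im, h, zero_sub, abs_neg] at this
    linarith
  refine hasDerivAt_integral_of_dominated_loc_of_deriv_le (F := fun (q : ℂ) (x : ℝ) => E x / (x - q))
    (F' := fun (q : ℂ) (x : ℝ) => E x / (x - q) ^ 2) (x₀ := p)
    (s := Metric.ball p (|p.im| / 2)) (bound := fun x : ℝ => 4 / |p.im| * ‖E x / (x - p)‖)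
    (Metric.ball_mem_nhds _ (by positivity)) ?_ (kernel_int hE p hp) ?_ ?_
    ((kernel_int hE p hp).norm.const_mul _) ?_
  · filter_upwards [Metric.ball_mem_nhds p (ε := |p.im| / 2) (by positivity)] with q hq
    exact (kernel_int hE q (hnear q hq)).aestronglyMeasurable
  · apply Continuous.aestronglyMeasurable
    exact Continuous.div (by fun_prop) (by fun_prop) (fun x => pow_ne_zero 2 (real_sub_ne hp x))
  · refine Eventually.of_forall fun x q hq => ?_
    rw [Metric.mem_ball, dist_eq_norm] at hq
    have h1 : |p.im| ≤ ‖(x : ℂ) - p‖ := by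
      simpa using Complex.abs_im_le_norm ((x : ℂ) - p)
    have h2 : ‖(x : ℂ) - p‖ / 2 ≤ ‖(x : ℂ) - q‖ := by
      have : ‖(x : ℂ) - p‖ ≤ ‖(x : ℂ) - q‖ + ‖q - p‖ := by
        calc ‖(x : ℂ) - p‖ = ‖((x : ℂ) - q) + (q - p)‖ := by ring_nf
          _ ≤ _ := norm_add_le _ _
      linarith
    have h3 : 0 < ‖(x : ℂ) - p‖ := by linarith
    rw [norm_div, norm_div, norm_pow]
    have h4 : |p.im| * ‖(x : ℂ) - p‖ / 4 ≤ ‖(x : ℂ) - q‖ ^ 2 := by nlinarith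
    calc ‖E x‖ / ‖(x : ℂ) - q‖ ^ 2 ≤ ‖E x‖ / (|p.im| * ‖(x : ℂ) - p‖ / 4) := by
          gcongr
      _ = _ := by field_simp
  · refine Eventually.of_forall fun x q hq => ?_
    have hne := real_sub_ne (hnear q hq) x
    have h := ((hasDerivAt_id q).const_sub (x : ℂ)).inv hne
    have h' := h.const_mul (E x)
    have hfun : (fun q : ℂ => E x / (x - q)) = fun y => E x * (fun q : ℂ => (x : ℂ) - id q)⁻¹ y := by
      funext y
      simp [div_eq_mul_inv]
    rw [hfun]
    have hval : E x / (x - q) ^ 2 = E x * (- -1 / ((x : ℂ) - id q) ^ 2) := by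
      rw [neg_neg, mul_one_div, id]
    rw [hval]
    exact h'

lemma cauchy_out2 {E : ℂ → ℂ} {M : ℝ} (hE : H2U E M) (p : ℂ) (hp : p.im < 0) :
    ∫ x : ℝ, E x / (x - p) ^ 2 = 0 := by
  have h := (cauchy_deriv hE p hp.ne).2
  have h2 : HasDerivAt (fun q : ℂ => ∫ x : ℝ, E x / (x - q)) 0 p := by
    refine (hasDerivAt_const p (0 : ℂ)).congr_of_eventuallyEq ?_
    filter_upwards [(isOpen_lt Complex.continuous_im continuous_const).mem_nhds hp] with q hq
    exact cauchy_out hE q hq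
  exact h.unique h2

lemma cauchy_in2 {E : ℂ → ℂ} {M : ℝ} (hE : H2U E M) (p : ℂ) (hp : 0 < p.im) :
    ∫ x : ℝ, E x / (x - p) ^ 2 = 2 * π * I * deriv E p := by
  have h := (cauchy_deriv hE p hp.ne').2
  have h2 : HasDerivAt (fun q : ℂ => ∫ x : ℝ, E x / (x - q)) (2 * π * I * deriv E p) p := by
    refine ((hE.diff p).hasDerivAt.const_mul (2 * π * I)).congr_of_eventuallyEq ?_
    filter_upwards [(isOpen_lt continuous_const Complex.continuous_im).mem_nhds hp] with q hq
    exact cauchy_in hE q hq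
  exact h.unique h2

lemma norm_exp_I_le (z : ℂ) : ‖Complex.exp (z * I)‖ ≤ Real.exp |z.im| := by
  rw [Complex.norm_exp]
  apply Real.exp_le_exp.2
  simp only [mul_re, I_re, mul_zero, I_im, mul_one, zero_sub]
  exact neg_le_abs _

lemma norm_exp_negI_le (z : ℂ) : ‖Complex.exp (-z * I)‖ ≤ Real.exp |z.im| := by
  have := norm_exp_I_le (-z)
  simpa using this

lemma norm_sin_le' (z : ℂ) : ‖Complex.sin z‖ ≤ Real.exp |z.im| := by
  rw [Complex.sin, norm_div, norm_mul, Complex.norm_I, mul_one, Complex.norm_two, div_le_iff₀ two_pos]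
  have := norm_sub_le (Complex.exp (-z * I)) (Complex.exp (z * I))
  linarith [norm_exp_I_le z, norm_exp_negI_le z]

lemma norm_cos_le' (z : ℂ) : ‖Complex.cos z‖ ≤ Real.exp |z.im| := by
  rw [Complex.cos, norm_div, Complex.norm_two, div_le_iff₀ two_pos]
  have := norm_add_le (Complex.exp (z * I)) (Complex.exp (-z * I))
  linarith [norm_exp_I_le z, norm_exp_negI_le z]

lemma norm_csinc_le (z : ℂ) : ‖csinc z‖ ≤ Real.exp |z.im| := by
  unfold csinc
  split_ifs with h
  · subst h; simp
  · rw [norm_div, div_le_iff₀ (norm_pos_iff.2 h)]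
    have hconv : Convex ℝ {u : ℂ | u.im ≤ |z.im| ∧ -|z.im| ≤ u.im} :=
      (convex_halfSpace_im_le _).inter (convex_halfSpace_im_ge _)
    have := hconv.norm_image_sub_le_of_norm_deriv_le (f := Complex.sin) (C := Real.exp |z.im|) (x := 0) (y := z)
      (fun u _ => Complex.differentiableAt_sin) ?_ ?_ ?_
    · simpa using this
    · intro u hu
      rw [Complex.deriv_sin]
      exact (norm_cos_le' u).trans (Real.exp_le_exp.2 (abs_le.2 ⟨hu.2, hu.1⟩))
    · simp
    · exact ⟨le_abs_self _, neg_abs_le _⟩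

lemma csinc_mul (z : ℂ) : csinc z * z = Complex.sin z := by
  unfold csinc
  split_ifs with h
  · subst h; simp
  · field_simp

lemma csinc_diff : Differentiable ℂ csinc := by
  have h : csinc = dslope Complex.sin 0 := by
    funext z
    by_cases hz : z = 0
    · subst hz; simp [csinc]
    · rw [dslope_of_ne _ hz, slope_def_field, csinc, if_neg hz]; simp
  rw [h, ← differentiableOn_univ, Complex.differentiableOn_dslope Filter.univ_mem]
  exact Complex.differentiable_sin.differentiableOn

lemma csinc_neg (z : ℂ) : csinc (-z) = csinc z := by
  unfold csinc
  simp [neg_div_neg_eq]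

lemma csinc_conj (z : ℂ) : csinc ((starRingEnd ℂ) z) = (starRingEnd ℂ) (csinc z) := by
  unfold csinc
  by_cases h : z = 0
  · simp [h]
  · simp [h, Complex.sin_conj]

lemma csinc_L2 (ω : ℂ) : Integrable (fun x : ℝ => ‖csinc (π * (x - ω))‖ ^ 2) := by
  have hc := csinc_diff.continuous
  have hi : Integrable (fun x : ℝ => 2 * Real.exp (π * |ω.im|) ^ 2 * (1 + (x - ω.re) ^ 2)⁻¹) :=
    (integrable_inv_one_add_sq.comp_sub_right ω.re).const_mul _
  refine hi.mono' (Continuous.aestronglyMeasurable (by fun_prop)) (Eventually.of_forall fun x => ?_)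
  have hπ := Real.pi_gt_three
  set z : ℂ := π * (x - ω) with hz
  have him : |z.im| = π * |ω.im| := by
    simp [hz, abs_mul, abs_of_pos Real.pi_pos]
  have h1 := norm_csinc_le z
  have h2 := norm_sin_le' z
  rw [← csinc_mul, norm_mul] at h2
  rw [him] at h1 h2
  have h3 : |x - ω.re| ≤ ‖z‖ := by
    have : |z.re| ≤ ‖z‖ := Complex.abs_re_le_norm z
    have e : z.re = π * (x - ω.re) := by simp [hz]
    rw [e, abs_mul, abs_of_pos Real.pi_pos] at this
    have := abs_nonneg (x - ω.re)
    nlinarith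
  rw [Real.norm_of_nonneg (by positivity), ← div_eq_mul_inv, le_div_iff₀ (by positivity)]
  have h4 : ‖csinc z‖ ^ 2 ≤ Real.exp (π * |ω.im|) ^ 2 := by gcongr
  have h5 : (‖csinc z‖ * |x - ω.re|) ^ 2 ≤ Real.exp (π * |ω.im|) ^ 2 := by
    have : ‖csinc z‖ * |x - ω.re| ≤ ‖csinc z‖ * ‖z‖ := by gcongr
    have := this.trans h2
    gcongr
  rw [mul_pow, sq_abs] at h5
  linarith

lemma csinc_exp (ω : ℂ) : ∀ ε > 0, ∃ C > 0, ∀ z : ℂ,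
    ‖csinc (π * (z - ω))‖ ≤ C * Real.exp ((π + ε) * ‖z‖) := by
  intro ε hε
  refine ⟨Real.exp (π * |ω.im|), Real.exp_pos _, fun z => ?_⟩
  refine (norm_csinc_le _).trans ?_
  rw [← Real.exp_add]
  apply Real.exp_le_exp.2
  have h1 : |((π : ℂ) * (z - ω)).im| = π * |z.im - ω.im| := by
    simp [abs_mul, abs_of_pos Real.pi_pos]
  rw [h1]
  have h2 := abs_sub z.im ω.im
  have h3 := Complex.abs_im_le_norm z
  have hπ := Real.pi_pos
  have : 0 ≤ ‖z‖ := norm_nonneg z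
  nlinarith

/-- Class of functions under consideration. -/
structure PW (F : ℂ → ℂ) : Prop where
  diff : Differentiable ℂ F
  exp : ∀ ε > 0, ∃ C > 0, ∀ z : ℂ, ‖F z‖ ≤ C * Real.exp ((π + ε) * ‖z‖)
  int : Integrable (fun x : ℝ => ‖F x‖ ^ 2)

lemma PW.neg {F : ℂ → ℂ} (h : PW F) : PW (fun z => F (-z)) := by
  refine ⟨?_, ?_, ?_⟩
  · have := h.diff; fun_prop
  · intro ε hε
    obtain ⟨C, hC, hb⟩ := h.exp ε hε
    exact ⟨C, hC, fun z => by simpa using hb (-z)⟩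
  · simpa using h.int.comp_neg

lemma PW_csinc (ω : ℂ) : PW (fun z => csinc (π * (z - ω))) :=
  ⟨csinc_diff.comp (by fun_prop), csinc_exp ω, csinc_L2 ω⟩

/-- The half of the integrand closing in the upper half plane. -/
noncomputable def Hf (F : ℂ → ℂ) (c : ℝ) (α β : ℂ) (u : ℂ) : ℂ :=
  F (u + c * I) * Complex.exp (I * π * (u + c * I)) *
    (α + β * Complex.exp (I * π * (u + c * I)) ^ 2)

lemma Hf_H2U {F : ℂ → ℂ} (h : PW F) (c : ℝ) (α β : ℂ) : ∃ M, H2U (Hf F c α β) M := by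
  set A := ∫ x : ℝ, ‖F x‖ ^ 2
  have hA : 0 ≤ A := integral_nonneg fun _ => by positivity
  set S := ‖α‖ + ‖β‖ * Real.exp (π * |c|) ^ 2 with hS
  have hS0 : 0 ≤ S := by positivity
  have hF := h.diff
  have hd : Differentiable ℂ (Hf F c α β) := by
    unfold Hf; fun_prop
  have hexpn : ∀ x y : ℝ, ‖Complex.exp (I * π * (((x : ℂ) + y * I) + c * I))‖ = Real.exp (-(π * (y + c))) := by
    intro x y
    rw [Complex.norm_exp]
    congr 1
    simp
  have hb : ∀ y : ℝ, 0 ≤ y → ∀ x : ℝ, ‖Hf F c α β (x + y * I)‖ ^ 2 ≤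
      (S * Real.exp (-(π * (y + c)))) ^ 2 * ‖F (x + (y + c : ℝ) * I)‖ ^ 2 := by
    intro y hy x
    rw [← mul_pow]
    apply pow_le_pow_left₀ (norm_nonneg _)
    have hz : (x : ℂ) + y * I + c * I = x + (y + c : ℝ) * I := by push_cast; ring
    unfold Hf
    rw [norm_mul, norm_mul, hexpn, hz]
    have h1 : ‖α + β * Complex.exp (I * π * (x + (y + c : ℝ) * I)) ^ 2‖ ≤ S := by
      refine (norm_add_le _ _).trans ?_
      rw [norm_mul, norm_pow, ← hz, hexpn, hS]
      have : -(π * (y + c)) ≤ π * |c| := by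
        have := Real.pi_pos
        have := neg_abs_le c
        nlinarith
      gcongr
    calc _ ≤ ‖F (x + (y + c : ℝ) * I)‖ * Real.exp (-(π * (y + c))) * S := by gcongr
      _ = _ := by ring
  have hi : ∀ y : ℝ, 0 ≤ y → Integrable (fun x : ℝ => ‖Hf F c α β (x + y * I)‖ ^ 2) := by
    intro y hy
    have hdc := hd.continuous
    refine ((pp F h.diff h.exp h.int (y + c)).1.const_mul ((S * Real.exp (-(π * (y + c)))) ^ 2)).mono'
      (Continuous.aestronglyMeasurable (by fun_prop)) (Eventually.of_forall fun x => ?_)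
    rw [Real.norm_of_nonneg (by positivity)]
    exact hb y hy x
  refine ⟨S ^ 2 * Real.exp (4 * π * |c|) * A, hd, hi, fun y hy => ?_⟩
  have hp := pp F h.diff h.exp h.int (y + c)
  refine (integral_mono (hi y hy) (hp.1.const_mul _) (hb y hy)).trans ?_
  rw [integral_const_mul]
  calc _ ≤ (S * Real.exp (-(π * (y + c)))) ^ 2 * (Real.exp (2 * π * |y + c|) * A) := by
        gcongr; exact hp.2
    _ = S ^ 2 * Real.exp (-(2 * π * (y + c)) + 2 * π * |y + c|) * A := by
        rw [mul_pow, ← Real.exp_nat_mul, Real.exp_add]; push_cast; ring_nf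
    _ ≤ _ := by
        have : -(2 * π * (y + c)) + 2 * π * |y + c| ≤ 4 * π * |c| := by
          have h1 := Real.pi_pos
          have h2 := neg_abs_le c
          have h3 := abs_nonneg c
          have h4 : |y + c| - (y + c) ≤ 2 * |c| := by
            rcases abs_cases (y + c) with h | h <;> linarith
          nlinarith
        gcongr

/-- The full entire integrand. -/
noncomputable def Phi (F : ℂ → ℂ) (ω z : ℂ) : ℂ :=
  F z * csinc (π * (z - ω)) * (1 - csinc (π * z) ^ 2)

lemma Phi_line {F : ℂ → ℂ} (h : PW F) (ω : ℂ) (y : ℝ) :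
    Integrable (fun x : ℝ => Phi F ω (x + y * I)) ∧
    ∫ x : ℝ, ‖Phi F ω (x + y * I)‖ ≤ (1 + Real.exp (π * |y|) ^ 2) *
      (Real.exp (2 * π * |y|) * (∫ x : ℝ, ‖F x‖ ^ 2) +
       Real.exp (2 * π * |y|) * (∫ x : ℝ, ‖csinc (π * (x - ω))‖ ^ 2)) := by
  have h1 := pp F h.diff h.exp h.int y
  have hG := PW_csinc ω
  have h2 := pp _ hG.diff hG.exp hG.int y
  have hb : ∀ x : ℝ, ‖Phi F ω (x + y * I)‖ ≤ (1 + Real.exp (π * |y|) ^ 2) *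
      (‖F (x + y * I)‖ ^ 2 + ‖csinc (π * ((x + y * I : ℂ) - ω))‖ ^ 2) := by
    intro x
    unfold Phi
    rw [norm_mul, norm_mul]
    have h3 := amgm ‖F (x + y * I)‖ ‖csinc (π * ((x + y * I : ℂ) - ω))‖ 1 one_pos
    have h4 : ‖1 - csinc (π * (x + y * I)) ^ 2‖ ≤ 1 + Real.exp (π * |y|) ^ 2 := by
      refine (norm_sub_le _ _).trans ?_
      rw [norm_one, norm_pow]
      have := norm_csinc_le (π * (x + y * I))
      have e : |((π : ℂ) * (x + y * I)).im| = π * |y| := by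
        simp [abs_mul, abs_of_pos Real.pi_pos]
      rw [e] at this
      gcongr
    rw [mul_comm]
    gcongr
    simpa using h3
  have hint : Integrable (fun x : ℝ => (1 + Real.exp (π * |y|) ^ 2) *
      (‖F (x + y * I)‖ ^ 2 + ‖csinc (π * ((x + y * I : ℂ) - ω))‖ ^ 2)) :=
    (h1.1.add h2.1).const_mul _
  have hi : Integrable (fun x : ℝ => Phi F ω (x + y * I)) := by
    refine hint.mono' ?_ (Eventually.of_forall hb)
    have := h.diff.continuous
    have := csinc_diff.continuous
    unfold Phi
    exact Continuous.aestronglyMeasurable (by fun_prop)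
  refine ⟨hi, (integral_mono hi.norm hint hb).trans ?_⟩
  rw [integral_const_mul, integral_add h1.1 h2.1]
  gcongr
  · exact h1.2
  · exact h2.2

lemma Phi_shift {F : ℂ → ℂ} (h : PW F) (ω : ℂ) (c : ℝ) (hc : 0 ≤ c) :
    ∫ x : ℝ, Phi F ω x = ∫ x : ℝ, Phi F ω (x + (-c : ℝ) * I) := by
  have := strip_shift (Phi F ω) (-c) 0 ((1 + Real.exp (π * c) ^ 2) *
      (Real.exp (2 * π * c) * (∫ x : ℝ, ‖F x‖ ^ 2) +
       Real.exp (2 * π * c) * (∫ x : ℝ, ‖csinc (π * (x - ω))‖ ^ 2))) (by linarith) ?_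
      (fun y _ => (Phi_line h ω y).1) ?_
  · simpa using this.symm
  · have := h.diff
    have := csinc_diff
    unfold Phi
    apply Differentiable.differentiableOn
    fun_prop
  · intro y hy
    refine (Phi_line h ω y).2.trans ?_
    have hyc : |y| ≤ c := abs_le.2 ⟨hy.1, hy.2.trans hc⟩
    have := Real.pi_pos
    have i1 : 0 ≤ ∫ x : ℝ, ‖F x‖ ^ 2 := integral_nonneg fun _ => by positivity
    have i2 : 0 ≤ ∫ x : ℝ, ‖csinc (π * (x - ω))‖ ^ 2 := integral_nonneg fun _ => by positivity
    gcongr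

lemma int4 {a b c d : ℝ → ℂ} (ha : Integrable a) (hb : Integrable b) (hc : Integrable c)
    (hd : Integrable d) : ∫ x, (a x - (b x - c x - d x)) =
      (∫ x, a x) - ((∫ x, b x) - (∫ x, c x) - ∫ x, d x) := by
  have i1 : Integrable (fun x => b x - c x) := hb.sub hc
  have i2 : Integrable (fun x => b x - c x - d x) := i1.sub hd
  rw [integral_sub ha i2, integral_sub i1 hd, integral_sub hb hc]

lemma part_in {A0 A1 : ℂ → ℂ} {M0 M1 : ℝ} (h0 : H2U A0 M0) (h1 : H2U A1 M1) (ω r p : ℂ)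
    (hr : 0 < r.im) (hp : 0 < p.im) :
    Integrable (fun x : ℝ => A0 x / (x - r) - (A1 x / (x - r) / ω ^ 2 - A1 x / (x - p) / ω ^ 2
      - A1 x / (x - p) ^ 2 / ω)) ∧
    ∫ x : ℝ, (A0 x / (x - r) - (A1 x / (x - r) / ω ^ 2 - A1 x / (x - p) / ω ^ 2
      - A1 x / (x - p) ^ 2 / ω)) =
    2 * π * I * (A0 r - (A1 r / ω ^ 2 - A1 p / ω ^ 2 - deriv A1 p / ω)) := by
  have i1 := kernel_int h0 r hr.ne'
  have i2 := (kernel_int h1 r hr.ne').div_const (ω ^ 2)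
  have i3 := (kernel_int h1 p hp.ne').div_const (ω ^ 2)
  have i4 := (cauchy_deriv h1 p hp.ne').1.div_const ω
  refine ⟨i1.sub ((i2.sub i3).sub i4), ?_⟩
  rw [int4 i1 i2 i3 i4,
    integral_div, integral_div, integral_div, cauchy_in h0 r hr, cauchy_in h1 r hr,
    cauchy_in h1 p hp, cauchy_in2 h1 p hp]
  ring

lemma part_out {A0 A1 : ℂ → ℂ} {M0 M1 : ℝ} (h0 : H2U A0 M0) (h1 : H2U A1 M1) (ω r p : ℂ)
    (hr : 0 < r.im) (hp : 0 < p.im) :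
    Integrable (fun x : ℝ => A0 (-x) / (x - r) - (A1 (-x) / (x - r) / ω ^ 2
      - A1 (-x) / (x - p) / ω ^ 2 - A1 (-x) / (x - p) ^ 2 / ω)) ∧
    ∫ x : ℝ, (A0 (-x) / (x - r) - (A1 (-x) / (x - r) / ω ^ 2 - A1 (-x) / (x - p) / ω ^ 2
      - A1 (-x) / (x - p) ^ 2 / ω)) = 0 := by
  have hr' : (-r).im < 0 := by simpa using hr
  have hp' : (-p).im < 0 := by simpa using hp
  have i1 := kernel_int h0 (-r) hr'.ne
  have i2 := (kernel_int h1 (-r) hr'.ne).div_const (ω ^ 2)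
  have i3 := (kernel_int h1 (-p) hp'.ne).div_const (ω ^ 2)
  have i4 := (cauchy_deriv h1 (-p) hp'.ne).1.div_const ω
  set S : ℝ → ℂ := fun x => -(A0 x / (x - (-r)) - (A1 x / (x - (-r)) / ω ^ 2
      - A1 x / (x - (-p)) / ω ^ 2 - -(A1 x / (x - (-p)) ^ 2 / ω))) with hS
  have hSi : Integrable S := (i1.sub ((i2.sub i3).sub i4.neg)).neg
  have hS0 : ∫ x, S x = 0 := by
    rw [hS, integral_neg, int4 i1 i2 i3 i4.fun_neg, integral_neg, integral_div, integral_div, integral_div, cauchy_out h0 _ hr', cauchy_out h1 _ hr',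
      cauchy_out h1 _ hp', cauchy_out2 h1 _ hp']
    simp
  have e : (fun x : ℝ => A0 (-x) / (x - r) - (A1 (-x) / (x - r) / ω ^ 2
      - A1 (-x) / (x - p) / ω ^ 2 - A1 (-x) / (x - p) ^ 2 / ω)) = fun x => S (-x) := by
    funext x
    have e1 : ((-x : ℝ) : ℂ) - -r = -((x : ℂ) - r) := by push_cast; ring
    have e2 : ((-x : ℝ) : ℂ) - -p = -((x : ℂ) - p) := by push_cast; ring
    simp only [hS]
    rw [e1, e2, div_neg, div_neg, div_neg, neg_sq]
    push_cast
    ring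
  rw [e]
  exact ⟨hSi.comp_neg, by rw [integral_neg_eq_self S volume]; exact hS0⟩

lemma partial_frac (ω z : ℂ) (hω : ω ≠ 0) (hz : z ≠ 0) (hzω : z - ω ≠ 0) (a : ℂ) :
    a / ((z - ω) * z ^ 2) = a / (z - ω) / ω ^ 2 - a / z / ω ^ 2 - a / z ^ 2 / ω := by
  field_simp
  ring

lemma Phi_split (F : ℂ → ℂ) (ω z X Y W V : ℂ) (hω : ω ≠ 0) (hz : z ≠ 0) (hzω : z - ω ≠ 0)
    (hXY : X * Y = 1)
    (hX : Complex.exp (I * π * z) = X) (hY : Complex.exp (I * π * (-z)) = Y)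
    (hW : Complex.exp (I * π * ω) = W) (hV : Complex.exp (I * π * (-ω)) = V) :
    Phi F ω z = (F z * X * (V * (-I / (2 * π)))) / (z - ω)
      - (F z * X * ((2 * V + W) * (-I / (8 * π ^ 3)) + -V * (-I / (8 * π ^ 3)) * X ^ 2) / (z - ω) / ω ^ 2
        - F z * X * ((2 * V + W) * (-I / (8 * π ^ 3)) + -V * (-I / (8 * π ^ 3)) * X ^ 2) / z / ω ^ 2
        - F z * X * ((2 * V + W) * (-I / (8 * π ^ 3)) + -V * (-I / (8 * π ^ 3)) * X ^ 2) / z ^ 2 / ω)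
      + ((F z * Y * (-W * (-I / (2 * π)))) / (z - ω)
      - (F z * Y * (-(2 * W + V) * (-I / (8 * π ^ 3)) + W * (-I / (8 * π ^ 3)) * Y ^ 2) / (z - ω) / ω ^ 2
        - F z * Y * (-(2 * W + V) * (-I / (8 * π ^ 3)) + W * (-I / (8 * π ^ 3)) * Y ^ 2) / z / ω ^ 2
        - F z * Y * (-(2 * W + V) * (-I / (8 * π ^ 3)) + W * (-I / (8 * π ^ 3)) * Y ^ 2) / z ^ 2 / ω)) := by
  have hπ : (π : ℂ) ≠ 0 := by exact_mod_cast Real.pi_ne_zero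
  rw [← partial_frac ω z hω hz hzω, ← partial_frac ω z hω hz hzω]
  have s1 : Complex.sin (π * (z - ω)) = (X * V - Y * W) * (-I) / 2 := by
    rw [Complex.sin, ← hX, ← hY, ← hW, ← hV, ← Complex.exp_add, ← Complex.exp_add]
    ring_nf
  have s2 : Complex.sin (π * z) = (X - Y) * (-I) / 2 := by
    rw [Complex.sin, ← hX, ← hY]
    ring_nf
  unfold Phi csinc
  rw [if_neg (mul_ne_zero hπ hzω), if_neg (mul_ne_zero hπ hz), s1, s2]
  have hI : I ^ 2 = -1 := I_sq
  have key : (X * V - Y * W) * (X - Y) ^ 2 =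
     -(X * (2 * V + W - V * X ^ 2) - Y * (2 * W + V - W * Y ^ 2)) := by
    linear_combination (-2 * X * V + 2 * Y * W - X * W + Y * V) * hXY
  have e1 : F z * ((X * V - Y * W) * -I / 2 / (π * (z - ω))) * (1 - ((X - Y) * -I / 2 / (π * z)) ^ 2)
     = F z * ((X * V - Y * W) * -I / 2 / (π * (z - ω))) +
       F z * ((X * V - Y * W) * (X - Y) ^ 2) * (-I) / 8 / π ^ 3 / ((z - ω) * z ^ 2) := by
    field_simp
    ring_nf
    simp only [hI]
    ring
  rw [e1, key]
  field_simp
  ring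

lemma main_formula {F : ℂ → ℂ} (h : PW F) (ω : ℂ) (hω : ω ≠ 0) :
    ∫ x : ℝ, Phi F ω x = F ω * (1 - 1 / (2 * π ^ 2 * ω ^ 2))
      + deriv F 0 * Complex.cos (π * ω) / (2 * π ^ 2 * ω)
      - F 0 * Complex.sin (π * ω) / (2 * π * ω)
      + F 0 * Complex.cos (π * ω) / (2 * π ^ 2 * ω ^ 2) := by
  have hπ : (π : ℂ) ≠ 0 := by exact_mod_cast Real.pi_ne_zero
  set c : ℝ := 1 + |ω.im| with hc
  have hc0 : 0 < c := by positivity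
  set p : ℂ := c * I with hp
  set r : ℂ := ω + c * I with hr
  have hpim : 0 < p.im := by simpa [hp] using hc0
  have hrim : 0 < r.im := by
    have : r.im = ω.im + c := by simp [hr]
    rw [this]
    linarith [neg_abs_le ω.im]
  set W := Complex.exp (I * π * ω) with hW
  set V := Complex.exp (I * π * (-ω)) with hV
  have hWV : W * V = 1 := by
    rw [hW, hV, ← Complex.exp_add]; simp
  obtain ⟨M0, hA0⟩ := Hf_H2U h (-c) (V * (-I / (2 * π))) 0
  obtain ⟨M1, hA1⟩ := Hf_H2U h (-c) ((2 * V + W) * (-I / (8 * π ^ 3))) (-V * (-I / (8 * π ^ 3)))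
  obtain ⟨N0, hB0⟩ := Hf_H2U h.neg c (-W * (-I / (2 * π))) 0
  obtain ⟨N1, hB1⟩ := Hf_H2U h.neg c (-(2 * W + V) * (-I / (8 * π ^ 3))) (W * (-I / (8 * π ^ 3)))
  obtain ⟨ji, jv⟩ := part_in hA0 hA1 ω r p hrim hpim
  obtain ⟨ki, kv⟩ := part_out hB0 hB1 ω r p hrim hpim
  rw [Phi_shift h ω c hc0.le]
  have e' : ∀ x : ℝ, Phi F ω (x + (-c : ℝ) * I) =
      (Hf F (-c) (V * (-I / (2 * π))) 0 x / (x - r) -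
        (Hf F (-c) ((2 * V + W) * (-I / (8 * π ^ 3))) (-V * (-I / (8 * π ^ 3))) x / (x - r) / ω ^ 2
        - Hf F (-c) ((2 * V + W) * (-I / (8 * π ^ 3))) (-V * (-I / (8 * π ^ 3))) x / (x - p) / ω ^ 2
        - Hf F (-c) ((2 * V + W) * (-I / (8 * π ^ 3))) (-V * (-I / (8 * π ^ 3))) x / (x - p) ^ 2 / ω))
      + (Hf (fun z => F (-z)) c (-W * (-I / (2 * π))) 0 (-x) / (x - r) -
        (Hf (fun z => F (-z)) c (-(2 * W + V) * (-I / (8 * π ^ 3))) (W * (-I / (8 * π ^ 3))) (-x) / (x - r) / ω ^ 2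
        - Hf (fun z => F (-z)) c (-(2 * W + V) * (-I / (8 * π ^ 3))) (W * (-I / (8 * π ^ 3))) (-x) / (x - p) / ω ^ 2
        - Hf (fun z => F (-z)) c (-(2 * W + V) * (-I / (8 * π ^ 3))) (W * (-I / (8 * π ^ 3))) (-x) / (x - p) ^ 2 / ω)) := by
    intro x
    have z1 : (x : ℂ) - p = x + (-c : ℝ) * I := by rw [hp]; push_cast; ring
    have z2 : (x : ℂ) - r = x + (-c : ℝ) * I - ω := by rw [hr]; push_cast; ring
    have z5 : (-x : ℂ) + c * I = -(x + (-c : ℝ) * I) := by push_cast; ring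
    have z3 : (x : ℂ) + (-c : ℝ) * I ≠ 0 := by rw [← z1]; exact real_sub_ne hpim.ne' x
    have z4 : (x : ℂ) + (-c : ℝ) * I - ω ≠ 0 := by rw [← z2]; exact real_sub_ne hrim.ne' x
    rw [z1, z2]
    unfold Hf
    rw [z5]
    beta_reduce
    rw [neg_neg]
    generalize hz : (x : ℂ) + (-c : ℝ) * I = z at z3 z4
    have hXY : Complex.exp (I * π * z) * Complex.exp (I * π * (-z)) = 1 := by
      rw [← Complex.exp_add]; simp
    have := Phi_split F ω z _ _ W V hω z3 z4 hXY rfl rfl rfl rfl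
    rw [this]
    simp only [zero_mul, add_zero]
  rw [integral_congr_ae (Eventually.of_forall e'), integral_add ji ki, jv, kv, add_zero]
  have r0 : r + (-c : ℝ) * I = ω := by rw [hr]; push_cast; ring
  have p0 : p + (-c : ℝ) * I = 0 := by rw [hp]; push_cast; ring
  have v1 : Hf F (-c) (V * (-I / (2 * π))) 0 r = F ω * (-I / (2 * π)) := by
    unfold Hf; rw [r0, ← hW]
    linear_combination F ω * (-I / (2 * π)) * hWV
  have v2 : Hf F (-c) ((2 * V + W) * (-I / (8 * π ^ 3))) (-V * (-I / (8 * π ^ 3))) r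
      = 2 * F ω * (-I / (8 * π ^ 3)) := by
    unfold Hf; rw [r0, ← hW]
    linear_combination F ω * (-I / (8 * π ^ 3)) * (2 - W ^ 2) * hWV
  have v3 : Hf F (-c) ((2 * V + W) * (-I / (8 * π ^ 3))) (-V * (-I / (8 * π ^ 3))) p
      = F 0 * (W + V) * (-I / (8 * π ^ 3)) := by
    unfold Hf; rw [p0]; simp; ring
  have v4 : deriv (Hf F (-c) ((2 * V + W) * (-I / (8 * π ^ 3))) (-V * (-I / (8 * π ^ 3)))) p
      = deriv F 0 * (W + V) * (-I / (8 * π ^ 3)) + F 0 * (-I / (8 * π ^ 3)) * (I * π * (W - V)) := by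
    have d1 : HasDerivAt (fun u : ℂ => u + (-c : ℝ) * I) 1 p := (hasDerivAt_id p).add_const _
    have d2 : HasDerivAt (fun u : ℂ => F (u + (-c : ℝ) * I)) (deriv F 0) p := by
      have : HasDerivAt F (deriv F 0) (p + (-c : ℝ) * I) := by
        rw [p0]; exact h.diff.differentiableAt.hasDerivAt
      have q := this.comp p d1
      rw [mul_one] at q
      exact q
    have d3 : HasDerivAt (fun u : ℂ => Complex.exp (I * π * (u + (-c : ℝ) * I))) (I * π) p := by
      have := (d1.const_mul (I * π)).cexp
      rw [p0] at this
      simpa using this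
    have d4 := (d2.mul d3).mul (((d3.pow 2).const_mul (-V * (-I / (8 * π ^ 3)))).const_add
      ((2 * V + W) * (-I / (8 * π ^ 3))))
    have d5 := d4.deriv
    simp only [p0, mul_zero, Complex.exp_zero, Pi.mul_apply, Pi.pow_apply] at d5
    refine Eq.trans ?_ (d5.trans ?_)
    · rfl
    · push_cast; ring
  rw [v1, v2, v3, v4]
  have cs : Complex.cos (π * ω) = (W + V) / 2 := by
    rw [Complex.cos, hW, hV]; ring_nf
  have sn : Complex.sin (π * ω) = (V - W) * I / 2 := by
    rw [Complex.sin, hW, hV]; ring_nf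
  rw [cs, sn]
  have hI : I ^ 2 = -1 := I_sq
  field_simp
  ring_nf
  simp only [hI, show I ^ 3 = -I by rw [pow_succ, hI]; ring]
  ring

lemma a_pos : 0 < invSqrt2 := by unfold invSqrt2; positivity

lemma sqrt_two_eq : Real.sqrt 2 = 2 * invSqrt2 := by
  unfold invSqrt2
  have : Real.sqrt 2 ≠ 0 := by positivity
  field_simp
  exact Real.sq_sqrt (by norm_num)

lemma a_sq : invSqrt2 ^ 2 = 1 / 2 := by
  unfold invSqrt2
  rw [inv_pow, Real.sq_sqrt (by norm_num)]; norm_num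

lemma a_sqC : (invSqrt2 : ℂ) ^ 2 = 1 / 2 := by
  rw [← Complex.ofReal_pow, a_sq]; norm_num

lemma z0_eq : (((π * Real.sqrt 2)⁻¹ : ℝ) : ℂ) = invSqrt2 / π := by
  rw [mul_inv, mul_comm, ← div_eq_mul_inv]
  unfold invSqrt2
  push_cast
  rfl

lemma pi_ne : (π : ℂ) ≠ 0 := by exact_mod_cast Real.pi_ne_zero

lemma a_ne : (invSqrt2 : ℂ) ≠ 0 := by exact_mod_cast a_pos.ne'

lemma sing_iff (z : ℂ) : 1 - 2 * (π : ℂ) ^ 2 * z ^ 2 = 0 ↔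
    z = invSqrt2 / π ∨ z = -(invSqrt2 / π) := by
  have h : 1 - 2 * (π : ℂ) ^ 2 * z ^ 2 =
      -2 * π ^ 2 * ((z - invSqrt2 / π) * (z - -(invSqrt2 / π))) := by
    have := pi_ne
    field_simp
    linear_combination (-2) * a_sqC
  rw [h]
  have := pi_ne
  simp [sub_eq_zero, add_eq_zero_iff_eq_neg]

lemma arg1 (z : ℂ) : (π : ℂ) * (z - invSqrt2 / π) = π * z - invSqrt2 := by
  have := pi_ne
  field_simp

lemma arg2 (z : ℂ) : (π : ℂ) * (z - -(invSqrt2 / π)) = π * z + invSqrt2 := by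
  have := pi_ne
  field_simp
  ring

lemma sing_val : csinc (invSqrt2 + invSqrt2) = (Real.sin (Real.sqrt 2) / Real.sqrt 2 : ℝ) := by
  have h : (invSqrt2 : ℂ) + invSqrt2 = (Real.sqrt 2 : ℝ) := by
    rw [sqrt_two_eq]; push_cast; ring
  rw [h, csinc, if_neg]
  · push_cast; rfl
  · have : Real.sqrt 2 ≠ 0 := by positivity
    exact_mod_cast this

lemma csinc_zero : csinc 0 = 1 := by simp [csinc]

lemma pts (z : ℂ) (h : z = invSqrt2 / π) :
    csinc (π * (z - invSqrt2 / π)) = 1 ∧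
    csinc (π * (z - -(invSqrt2 / π))) = (Real.sin (Real.sqrt 2) / Real.sqrt 2 : ℝ) := by
  rw [arg1, arg2, ← sing_val, ← csinc_zero, h, mul_div_cancel₀ _ pi_ne, sub_self]
  exact ⟨rfl, rfl⟩

lemma pts' (z : ℂ) (h : z = -(invSqrt2 / π)) :
    csinc (π * (z - -(invSqrt2 / π))) = 1 ∧
    csinc (π * (z - invSqrt2 / π)) = (Real.sin (Real.sqrt 2) / Real.sqrt 2 : ℝ) := by
  rw [arg1, arg2, ← sing_val, ← csinc_zero, h, mul_neg, mul_div_cancel₀ _ pi_ne, neg_add_cancel,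
    ← csinc_neg (-_ - _)]
  refine ⟨rfl, ?_⟩
  congr 1
  ring

lemma nonsing (z : ℂ) (h : 1 - 2 * (π : ℂ) ^ 2 * z ^ 2 ≠ 0) :
    (π * z - invSqrt2 ≠ 0) ∧ (π * z + invSqrt2 ≠ 0) := by
  have e : 1 - 2 * (π : ℂ) ^ 2 * z ^ 2 = -2 * ((π * z - invSqrt2) * (π * z + invSqrt2)) := by
    linear_combination (-2) * a_sqC
  rw [e] at h
  simpa [not_or] using h

lemma gFun_eq (z : ℂ) : gFun z =
    (csinc (π * (z - invSqrt2 / π)) + csinc (π * (z - -(invSqrt2 / π)))) / 2 := by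
  unfold gFun
  split_ifs with h
  · rcases (sing_iff z).1 h with h | h
    · obtain ⟨h1, h2⟩ := pts z h
      rw [h1, h2, gSingVal]; push_cast; ring
    · obtain ⟨h1, h2⟩ := pts' z h
      rw [h1, h2, gSingVal]; push_cast; ring
  · obtain ⟨h1, h2⟩ := nonsing z h
    rw [arg1, arg2, csinc, csinc, if_neg h1, if_neg h2, Complex.sin_sub, Complex.sin_add,
      sqrt_two_eq]
    push_cast
    rw [div_add_div _ _ h1 h2, div_div, div_eq_div_iff h (by simp [h1, h2])]
    linear_combination (-2 * (2 * invSqrt2 * Complex.sin invSqrt2 * Complex.cos (π * z)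
      - 2 * (π * z) * Complex.cos invSqrt2 * Complex.sin (π * z))) * a_sqC

lemma hFun_eq (z : ℂ) : hFun z =
    (csinc (π * (z - invSqrt2 / π)) - csinc (π * (z - -(invSqrt2 / π)))) / 2 := by
  unfold hFun
  rw [z0_eq]
  split_ifs with h h'
  · obtain ⟨h1, h2⟩ := pts z h
    rw [h1, h2, hSingVal]; push_cast; ring
  · obtain ⟨h1, h2⟩ := pts' z h'
    rw [h1, h2, hSingVal]; push_cast; ring
  · have hs : 1 - 2 * (π : ℂ) ^ 2 * z ^ 2 ≠ 0 := by
      intro hh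
      rcases (sing_iff z).1 hh with h1 | h1
      · exact h h1
      · exact h' h1
    obtain ⟨h1, h2⟩ := nonsing z hs
    rw [arg1, arg2, csinc, csinc, if_neg h1, if_neg h2, Complex.sin_sub, Complex.sin_add,
      sqrt_two_eq]
    push_cast
    rw [div_sub_div _ _ h1 h2, div_div, div_eq_div_iff hs (by simp [h1, h2])]
    linear_combination (-2 * (2 * (π * z) * Complex.sin invSqrt2 * Complex.cos (π * z)
      - 2 * invSqrt2 * Complex.cos invSqrt2 * Complex.sin (π * z))) * a_sqC

lemma PW.add {F G : ℂ → ℂ} (hF : PW F) (hG : PW G) : PW (fun z => F z + G z) := by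
  have c1 := hF.diff.continuous
  have c2 := hG.diff.continuous
  refine ⟨hF.diff.add hG.diff, ?_, ?_⟩
  · intro ε hε
    obtain ⟨C, hC, hb⟩ := hF.exp ε hε
    obtain ⟨D, hD, hb'⟩ := hG.exp ε hε
    refine ⟨C + D, by positivity, fun z => (norm_add_le _ _).trans ?_⟩
    rw [add_mul]
    exact add_le_add (hb z) (hb' z)
  · refine ((hF.int.const_mul 2).add (hG.int.const_mul 2)).mono'
      (Continuous.aestronglyMeasurable (by fun_prop)) (Eventually.of_forall fun x => ?_)
    rw [Real.norm_of_nonneg (by positivity)]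
    have h := norm_add_le (F x) (G x)
    have : ‖F x + G x‖ ^ 2 ≤ (‖F x‖ + ‖G x‖) ^ 2 := by gcongr
    simp only [Pi.add_apply]
    nlinarith [sq_nonneg (‖F x‖ - ‖G x‖)]

lemma PW.smul {F : ℂ → ℂ} (hF : PW F) (k : ℂ) : PW (fun z => k * F z) := by
  refine ⟨hF.diff.const_mul k, ?_, ?_⟩
  · intro ε hε
    obtain ⟨C, hC, hb⟩ := hF.exp ε hε
    refine ⟨(‖k‖ + 1) * C, by positivity, fun z => ?_⟩
    rw [norm_mul, mul_assoc]
    have := hb z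
    have := norm_nonneg (F z)
    gcongr
    linarith
  · simp only [norm_mul, mul_pow]
    exact hF.int.const_mul _

/-- The coefficient of the shifted sinc. -/
noncomputable def eCoef (w : ℂ) : ℂ := 2 * (π : ℂ) ^ 2 * w ^ 2 / (2 * (π : ℂ) ^ 2 * w ^ 2 - 1)

lemma Kker_eq (w z : ℂ) : Kker w z = eCoef ((starRingEnd ℂ) w) * csinc (π * (z - (starRingEnd ℂ) w))
    + (cCoef ((starRingEnd ℂ) w) + dCoef ((starRingEnd ℂ) w)) / 2 * csinc (π * (z - invSqrt2 / π))
    + (cCoef ((starRingEnd ℂ) w) - dCoef ((starRingEnd ℂ) w)) / 2 * csinc (π * (z - -(invSqrt2 / π))) := by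
  unfold Kker fFun eCoef
  rw [gFun_eq, hFun_eq]
  ring

lemma Kker_PW (w : ℂ) : PW (fun z => Kker w z) := by
  simp only [Kker_eq]
  exact (((PW_csinc _).smul _).add ((PW_csinc _).smul _)).add ((PW_csinc _).smul _)

lemma csinc_conj_real (x : ℝ) (ω : ℂ) : (starRingEnd ℂ) (csinc (π * (x - ω))) =
    csinc (π * (x - (starRingEnd ℂ) ω)) := by
  rw [← csinc_conj]
  simp

lemma eCoef_conj (w : ℂ) : (starRingEnd ℂ) (eCoef ((starRingEnd ℂ) w)) = eCoef w := by
  unfold eCoef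
  have h2 : (starRingEnd ℂ) 2 = 2 := map_ofNat _ 2
  simp [h2]

lemma cCoef_conj (w : ℂ) : (starRingEnd ℂ) (cCoef ((starRingEnd ℂ) w)) = cCoef w := by
  unfold cCoef
  have h : (π : ℂ) * (starRingEnd ℂ) w = (starRingEnd ℂ) (π * w) := by simp
  rw [h, Complex.cos_conj, Complex.sin_conj]
  have h2 : (starRingEnd ℂ) 2 = 2 := map_ofNat _ 2
  simp [h2, -Complex.ofReal_cos, -Complex.ofReal_sin]

lemma dCoef_conj (w : ℂ) : (starRingEnd ℂ) (dCoef ((starRingEnd ℂ) w)) = dCoef w := by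
  unfold dCoef
  have h : (π : ℂ) * (starRingEnd ℂ) w = (starRingEnd ℂ) (π * w) := by simp
  rw [h, Complex.cos_conj]
  have h2 : (starRingEnd ℂ) 2 = 2 := map_ofNat _ 2
  simp [h2, -Complex.ofReal_cos, -Complex.ofReal_sin]

lemma Kker_conj (w : ℂ) (x : ℝ) : (starRingEnd ℂ) (Kker w x) = eCoef w * csinc (π * (x - w))
    + (cCoef w + dCoef w) / 2 * csinc (π * (x - invSqrt2 / π))
    + (cCoef w - dCoef w) / 2 * csinc (π * (x - -(invSqrt2 / π))) := by
  rw [Kker_eq]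
  simp only [map_add, map_mul, map_sub, map_div₀, csinc_conj_real, eCoef_conj, cCoef_conj,
    dCoef_conj, Complex.conj_conj, map_neg, Complex.conj_ofReal, map_ofNat]

lemma pck_eq (x : ℝ) (hx : x ≠ 0) : (pairCorKernel x : ℂ) = 1 - csinc (π * x) ^ 2 := by
  have h : (π : ℂ) * x ≠ 0 := mul_ne_zero pi_ne (by exact_mod_cast hx)
  unfold pairCorKernel csinc
  rw [if_neg h]
  push_cast
  rfl

lemma pck_nonneg (x : ℝ) : 0 ≤ pairCorKernel x := by
  unfold pairCorKernel
  have h : |Real.sin (π * x) / (π * x)| ≤ 1 := by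
    rw [abs_div]
    exact div_le_one_of_le₀ Real.abs_sin_le_abs (abs_nonneg _)
  have := (sq_le_one_iff_abs_le_one _).2 h
  linarith

lemma pck_le_one (x : ℝ) : pairCorKernel x ≤ 1 := by
  unfold pairCorKernel
  have := sq_nonneg (Real.sin (π * x) / (π * x))
  linarith

lemma pck_half (x : ℝ) (hx : 1 ≤ |x|) : 1 / 2 ≤ pairCorKernel x := by
  unfold pairCorKernel
  have h : |Real.sin (π * x) / (π * x)| ≤ 1 / 2 := by
    have h3 := Real.pi_gt_three
    have h2 : 2 ≤ |π * x| := by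
      rw [abs_mul, abs_of_pos Real.pi_pos]; nlinarith
    rw [abs_div, div_le_iff₀ (by linarith)]
    have := Real.abs_sin_le_one (π * x)
    linarith
  have := sq_le_sq' (abs_le.1 h).1 (abs_le.1 h).2
  linarith

lemma pck_meas : Measurable pairCorKernel := by
  unfold pairCorKernel
  fun_prop

lemma int_mu_iff {E : Type*} [NormedAddCommGroup E] [NormedSpace ℝ E] (g : ℝ → E) :
    Integrable g pairCorMeasure ↔ Integrable (fun x => pairCorKernel x • g x) := by
  unfold pairCorMeasure
  rw [integrable_withDensity_iff_integrable_smul' (by have := pck_meas; fun_prop) (by simp)]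
  simp only [ENNReal.toReal_ofReal (pck_nonneg _)]

lemma int_mu (g : ℝ → ℂ) :
    ∫ x, g x ∂pairCorMeasure = ∫ x, pairCorKernel x • g x := by
  unfold pairCorMeasure
  rw [integral_withDensity_eq_integral_toReal_smul (by have := pck_meas; fun_prop) (by simp)]
  simp only [ENNReal.toReal_ofReal (pck_nonneg _)]

lemma PW_int_mu {F : ℂ → ℂ} (h : PW F) : Integrable (fun x : ℝ => ‖F x‖ ^ 2) pairCorMeasure := by
  rw [int_mu_iff]
  refine h.int.mono' (pck_meas.aestronglyMeasurable.smul h.int.aestronglyMeasurable)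
    (Eventually.of_forall fun x => ?_)
  rw [norm_smul, Real.norm_of_nonneg (pck_nonneg x), Real.norm_of_nonneg (by positivity)]
  exact mul_le_of_le_one_left (by positivity) (pck_le_one x)

lemma L2_of_mu {F : ℂ → ℂ} (hF : Differentiable ℂ F)
    (h : Integrable (fun x : ℝ => ‖F x‖ ^ 2) pairCorMeasure) :
    Integrable (fun x : ℝ => ‖F x‖ ^ 2) := by
  rw [int_mu_iff] at h
  have hc := hF.continuous
  have hcont : Continuous (fun x : ℝ => ‖F x‖ ^ 2) := by fun_prop
  have hI : Integrable ((Set.Icc (-1 : ℝ) 1).indicator (fun x : ℝ => ‖F x‖ ^ 2)) :=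
    (hcont.continuousOn.integrableOn_compact isCompact_Icc).integrable_indicator measurableSet_Icc
  refine (hI.add (h.const_mul 2)).mono' hcont.aestronglyMeasurable (Eventually.of_forall fun x => ?_)
  rw [Real.norm_of_nonneg (by positivity), Pi.add_apply, smul_eq_mul]
  have hn := pck_nonneg x
  have h0 : 0 ≤ ‖F x‖ ^ 2 := by positivity
  by_cases hx : x ∈ Set.Icc (-1 : ℝ) 1
  · rw [Set.indicator_of_mem hx]
    have := mul_nonneg hn h0
    linarith
  · rw [Set.indicator_of_notMem hx]
    have : 1 ≤ |x| := by
      by_contra hh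
      exact hx (abs_le.1 (not_le.1 hh).le)
    have := pck_half x this
    nlinarith

lemma cos_a_pos : 3 / 4 ≤ Real.cos invSqrt2 := by
  have := Real.one_sub_sq_div_two_le_cos (x := invSqrt2)
  rw [a_sq] at this
  linarith

lemma ca_ne : (Real.cos invSqrt2 : ℂ) ≠ 0 := by
  have := cos_a_pos
  exact_mod_cast (by linarith : 0 < Real.cos invSqrt2).ne'

lemma cas_ne : (Real.cos invSqrt2 : ℂ) - invSqrt2 * (Real.sin invSqrt2 : ℂ) ≠ 0 := by
  have h1 := cos_a_pos
  have h2 := Real.sin_le a_pos.le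
  have h3 := a_sq
  have h4 := a_pos
  have : Real.cos invSqrt2 - invSqrt2 * Real.sin invSqrt2 ≠ 0 := by
    apply ne_of_gt
    nlinarith
  exact_mod_cast this

lemma Phi_int {F : ℂ → ℂ} (h : PW F) (ω : ℂ) : Integrable (fun x : ℝ => Phi F ω x) := by
  simpa using (Phi_line h ω 0).1

lemma L_pos {F : ℂ → ℂ} (h : PW F) : ∫ x : ℝ, Phi F (invSqrt2 / π) x =
    deriv F 0 * (Real.cos invSqrt2 : ℂ) * invSqrt2 / π +
    F 0 * ((Real.cos invSqrt2 : ℂ) - invSqrt2 * (Real.sin invSqrt2 : ℂ)) := by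
  rw [main_formula h _ (div_ne_zero a_ne pi_ne), mul_div_cancel₀ _ pi_ne]
  have := pi_ne
  have ha := a_ne
  have h2 := a_sqC
  have e1 : 2 * (π : ℂ) ^ 2 * (invSqrt2 / π) ^ 2 = 1 := by
    field_simp
    linear_combination 2 * h2
  have e2 : 2 * (π : ℂ) ^ 2 * (invSqrt2 / π) = π / invSqrt2 := by
    field_simp
    linear_combination 2 * h2
  have e3 : 2 * (π : ℂ) * (invSqrt2 / π) = 1 / invSqrt2 := by
    field_simp
    linear_combination 2 * h2
  push_cast
  rw [e1, e2, e3, div_div_eq_mul_div, div_div_eq_mul_div]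
  ring

lemma L_neg {F : ℂ → ℂ} (h : PW F) : ∫ x : ℝ, Phi F (-(invSqrt2 / π)) x =
    -(deriv F 0 * (Real.cos invSqrt2 : ℂ) * invSqrt2 / π) +
    F 0 * ((Real.cos invSqrt2 : ℂ) - invSqrt2 * (Real.sin invSqrt2 : ℂ)) := by
  rw [main_formula h _ (neg_ne_zero.2 (div_ne_zero a_ne pi_ne)), mul_neg, mul_div_cancel₀ _ pi_ne,
    Complex.cos_neg, Complex.sin_neg]
  have := pi_ne
  have ha := a_ne
  have h2 := a_sqC
  have e1 : 2 * (π : ℂ) ^ 2 * (invSqrt2 / π) ^ 2 = 1 := by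
    field_simp
    linear_combination 2 * h2
  have e2 : 2 * (π : ℂ) ^ 2 * (invSqrt2 / π) = π / invSqrt2 := by
    field_simp
    linear_combination 2 * h2
  have e3 : 2 * (π : ℂ) * (invSqrt2 / π) = 1 / invSqrt2 := by
    field_simp
    linear_combination 2 * h2
  push_cast
  rw [neg_sq, e1, mul_neg, e2, mul_neg (2 * (π : ℂ)), e3, div_neg, div_neg, div_div_eq_mul_div,
    div_div_eq_mul_div]
  ring

lemma L_w {F : ℂ → ℂ} (h : PW F) (w : ℂ) (hw : 2 * (π : ℂ) ^ 2 * w ^ 2 ≠ 1) :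
    eCoef w * ∫ x : ℝ, Phi F w x = F w + (w * Complex.cos (π * w) * deriv F 0 +
      F 0 * (Complex.cos (π * w) - π * w * Complex.sin (π * w))) / (2 * π ^ 2 * w ^ 2 - 1) := by
  have hw' : 2 * (π : ℂ) ^ 2 * w ^ 2 - 1 ≠ 0 := sub_ne_zero.2 hw
  have := pi_ne
  by_cases h0 : w = 0
  · subst h0; simp [eCoef, div_neg]
  · rw [main_formula h w h0]
    unfold eCoef
    rw [div_mul_eq_mul_div, eq_comm, eq_div_iff hw', add_mul, div_mul_cancel₀ _ hw']
    field_simp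
    ring

theorem Kker_is_reproducing_kernel (w : ℂ) (hw : 2 * (π : ℂ) ^ 2 * w ^ 2 ≠ 1) :
    Differentiable ℂ (fun z => Kker w z) ∧
    HasExpTypeLE (fun z => Kker w z) π ∧
    Integrable (fun x : ℝ => ‖Kker w x‖ ^ 2) pairCorMeasure ∧
    ∀ F : ℂ → ℂ, Differentiable ℂ F → HasExpTypeLE F π →
      Integrable (fun x : ℝ => ‖F x‖ ^ 2) pairCorMeasure →
      ∫ x : ℝ, F x * (starRingEnd ℂ) (Kker w x) ∂pairCorMeasure = F w := by
  have hK := Kker_PW w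
  refine ⟨hK.diff, hK.exp, PW_int_mu hK, fun F hF hexp hint => ?_⟩
  have h : PW F := ⟨hF, hexp, L2_of_mu hF hint⟩
  rw [int_mu]
  have hae : ∀ᵐ x : ℝ, pairCorKernel x • (F x * (starRingEnd ℂ) (Kker w x)) =
      eCoef w * Phi F w x + (cCoef w + dCoef w) / 2 * Phi F (invSqrt2 / π) x
      + (cCoef w - dCoef w) / 2 * Phi F (-(invSqrt2 / π)) x := by
    have : ∀ᵐ x : ℝ, x ≠ 0 := by simp [ae_iff]
    filter_upwards [this] with x hx
    rw [Complex.real_smul, pck_eq x hx, Kker_conj]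
    unfold Phi
    ring
  have i1 := (Phi_int h w).const_mul (eCoef w)
  have i2 := (Phi_int h (invSqrt2 / π)).const_mul ((cCoef w + dCoef w) / 2)
  have i3 := (Phi_int h (-(invSqrt2 / π))).const_mul ((cCoef w - dCoef w) / 2)
  have i12 : Integrable (fun x : ℝ => eCoef w * Phi F w x
      + (cCoef w + dCoef w) / 2 * Phi F (invSqrt2 / π) x) := i1.add i2
  rw [integral_congr_ae hae, integral_add i12 i3, integral_add i1 i2, integral_const_mul,
    integral_const_mul, integral_const_mul, L_w h w hw, L_pos h, L_neg h]
  have hw' : 2 * (π : ℂ) ^ 2 * w ^ 2 - 1 ≠ 0 := sub_ne_zero.2 hw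
  have hw2 : 1 - 2 * (π : ℂ) ^ 2 * w ^ 2 ≠ 0 := sub_ne_zero.2 hw.symm
  have hc : cCoef w * ((Real.cos invSqrt2 : ℂ) - invSqrt2 * (Real.sin invSqrt2 : ℂ)) =
      -((Complex.cos (π * w) - π * w * Complex.sin (π * w)) / (2 * π ^ 2 * w ^ 2 - 1)) := by
    unfold cCoef
    rw [div_mul_eq_mul_div, mul_div_mul_right _ _ cas_ne, ← div_neg]
    congr 1
    ring
  have hd : dCoef w * ((Real.cos invSqrt2 : ℂ) * invSqrt2 / π) =
      -(w * Complex.cos (π * w) / (2 * π ^ 2 * w ^ 2 - 1)) := by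
    have hq : dCoef w = w * Complex.cos (π * w) / (1 - 2 * π ^ 2 * w ^ 2) *
        (π / ((Real.cos invSqrt2 : ℂ) * invSqrt2)) := by
      unfold dCoef
      rw [sqrt_two_eq, div_mul_div_comm]
      have c1 := ca_ne
      have c2 := a_ne
      rw [Complex.ofReal_mul, Complex.ofReal_ofNat]
      rw [div_eq_div_iff]
      · ring
      · exact mul_ne_zero (mul_ne_zero hw2 (mul_ne_zero two_ne_zero c2)) c1
      · exact mul_ne_zero hw2 (mul_ne_zero c1 c2)
    have c1 := ca_ne
    have c2 := a_ne
    have c3 := pi_ne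
    rw [hq, mul_assoc, div_mul_div_cancel₀, div_self c3, mul_one, ← div_neg]
    · congr 1
      ring
    · exact mul_ne_zero c1 c2
  linear_combination F 0 * hc + deriv F 0 * hd
end
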